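/- arXiv:0812.5039 — 2 statements merged into one kernel-verified Lean document; each statement's English description precedes it below -/
import Mathlib

section
/- Fix an integer d ≥ 3, let t = ⌊d/2⌋ − 1, and define β_d(r) = α(r)^t / t! if d is even and β_d(r) = (α(r)^t / t!) · log₂(α(r)) if d is odd; define δ_d(r) = 1/α(r) if d is even and δ_d(r) = 1/log₂(α(r)) if d is odd. Then there exist a constant C > 0 and a threshold r_0 (both depending only on d) such that for every real r ≥ r_0 there exist pairwise distinct positive reals c_1, …, c_d, each different from 1, and a finite set X contained in the curve {(c_1^s, …, c_d^s) : s ∈ ℝ} ⊂ ℝ^d, such that every weak (1/r)-net N for X with respect to convex sets satisfies |N| ≥ r · 2^{(1 − C·δ_d(r))·β_d(r)}. In particular, for d = 3 the bound is |N| ≥ c·r·α(r) for some constant c > 0. -/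
open Classical in
/-- `N` is a weak `ε`-net for the finite set `X ⊂ ℝ^d` with respect to convex sets. -/
def IsWeakNet {d : ℕ} (X : Finset (Fin d → ℝ)) (ε : ℝ) (N : Set (Fin d → ℝ)) : Prop :=
  ∀ C : Set (Fin d → ℝ), Convex ℝ C →
    ε * X.card ≤ (X.filter (fun p => p ∈ C)).card → (N ∩ C).Nonempty

/-- The Ackermann hierarchy: `ackH k n = A_{k+1}(n)`. -/
def ackH : ℕ → ℕ → ℕ
  | 0, n => 2 * n
  | _ + 1, 0 => 1
  | k + 1, n + 1 => ackH k (ackH (k + 1) n)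

/-- The Ackermann function `A(n) = A_n(3)` (for `n ≥ 1`). -/
def ackA (n : ℕ) : ℕ := ackH (n - 1) 3

/-- The inverse Ackermann function `α(x) = min {n ≥ 1 : A(n) ≥ x}`. -/
noncomputable def alphaA (x : ℝ) : ℕ := sInf {n : ℕ | 1 ≤ n ∧ x ≤ ackA n}

/-- `β_d(r) = α(r)^t/t!` for even `d` and `(α(r)^t/t!)·log₂ α(r)` for odd `d`,
where `t = ⌊d/2⌋ - 1`. -/
noncomputable def betaD (d : ℕ) (r : ℝ) : ℝ :=
  if d % 2 = 0 then (alphaA r : ℝ) ^ (d / 2 - 1) / (Nat.factorial (d / 2 - 1) : ℝ)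
  else ((alphaA r : ℝ) ^ (d / 2 - 1) / (Nat.factorial (d / 2 - 1) : ℝ)) *
    Real.logb 2 (alphaA r)

/-- `δ_d(r) = 1/α(r)` for even `d` and `1/log₂ α(r)` for odd `d`. -/
noncomputable def deltaD (d : ℕ) (r : ℝ) : ℝ :=
  if d % 2 = 0 then 1 / (alphaA r : ℝ) else 1 / Real.logb 2 (alphaA r)

/-- The number of elements of `A` that are at most `x`. -/
def cutRank (A : Finset ℕ) (x : ℕ) : ℕ := (A.filter (· ≤ x)).card

/-- The number of intervals between consecutive elements of `A` that contain a point of `P`. -/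
def hitCount (A P : Finset ℕ) : ℕ := ((P.image (cutRank A)) ∩ Finset.Ioo 0 A.card).card

/-- In every window of length `n`, any `c * n` sets of at most `j` points leave unstabbed some
set of `κ` cuts: none of them meets `j` of the intervals between consecutive cuts. -/
def LeavesUnstabbed (j κ c n : ℕ) : Prop :=
  ∀ (s : ℕ) (Z : Finset (Finset ℕ)), (∀ P ∈ Z, P.card ≤ j) → Z.card ≤ c * n →
    ∃ A ⊆ Finset.Ico s (s + n), A.card = κ ∧ ∀ P ∈ Z, hitCount A P < j

lemma cutRank_le_card (A : Finset ℕ) (x : ℕ) : cutRank A x ≤ A.card :=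
  Finset.card_filter_le _ _

lemma cutRank_eq_zero {A : Finset ℕ} {x : ℕ} (h : ∀ a ∈ A, x < a) : cutRank A x = 0 := by
  unfold cutRank
  rw [Finset.card_eq_zero, Finset.filter_eq_empty_iff]
  intro a ha
  simpa using h a ha

lemma cutRank_eq_card {A : Finset ℕ} {x : ℕ} (h : ∀ a ∈ A, a ≤ x) : cutRank A x = A.card := by
  unfold cutRank
  rw [Finset.filter_true_of_mem h]

lemma cutRank_mono (A : Finset ℕ) : Monotone (cutRank A) := by
  intro x y hxy
  exact Finset.card_le_card (Finset.monotone_filter_right _ fun a _ (ha : a ≤ x) => ha.trans hxy)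

lemma cutRank_lt_cutRank {A : Finset ℕ} {x y a : ℕ} (ha : a ∈ A) (hx : x < a) (hy : a ≤ y) :
    cutRank A x < cutRank A y := by
  apply Finset.card_lt_card
  rw [Finset.ssubset_iff_of_subset]
  · exact ⟨a, by simp [ha, hy], by simp [hx]⟩
  · exact Finset.monotone_filter_right _ fun b _ (hb : b ≤ x) => hb.trans (hx.le.trans hy)

lemma hitCount_lt_of_not_subset {A P : Finset ℕ} {j s e : ℕ}
    (hA : A ⊆ Finset.Ico s e) (hP : P.card ≤ j) (hPs : ¬ P ⊆ Finset.Ico s e) :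
    hitCount A P < j := by
  obtain ⟨x, hxP, hx⟩ := Finset.not_subset.mp hPs
  have hsub : (P.image (cutRank A)) ∩ Finset.Ioo 0 A.card ⊆ (P.erase x).image (cutRank A) := by
    intro v hv
    simp only [Finset.mem_inter, Finset.mem_image, Finset.mem_Ioo] at hv
    obtain ⟨⟨y, hy, rfl⟩, h0, h1⟩ := hv
    refine Finset.mem_image_of_mem _ (Finset.mem_erase.mpr ⟨?_, hy⟩)
    rintro rfl
    rw [Finset.mem_Ico, not_and_or] at hx
    rcases hx with hx | hx
    · rw [cutRank_eq_zero fun a ha => by have := Finset.mem_Ico.mp (hA ha); omega] at h0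
      omega
    · rw [cutRank_eq_card fun a ha => by have := Finset.mem_Ico.mp (hA ha); omega] at h1
      omega
  calc hitCount A P ≤ ((P.erase x).image (cutRank A)).card := Finset.card_le_card hsub
    _ ≤ (P.erase x).card := Finset.card_image_le
    _ < P.card := Finset.card_erase_lt_of_mem hxP
    _ ≤ j := hP

lemma hitCount_eq_zero_of_disjoint {A P : Finset ℕ} {s e : ℕ}
    (hA : A ⊆ Finset.Ico s e) (hP : ∀ x ∈ P, x ∉ Finset.Ico s e) : hitCount A P = 0 := by
  unfold hitCount
  rw [Finset.card_eq_zero, Finset.eq_empty_iff_forall_notMem]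
  intro v hv
  simp only [Finset.mem_inter, Finset.mem_image, Finset.mem_Ioo] at hv
  obtain ⟨⟨y, hy, rfl⟩, h0, h1⟩ := hv
  have hx := hP y hy
  rw [Finset.mem_Ico, not_and_or] at hx
  rcases hx with hx | hx
  · rw [cutRank_eq_zero fun a ha => by have := Finset.mem_Ico.mp (hA ha); omega] at h0
    omega
  · rw [cutRank_eq_card fun a ha => by have := Finset.mem_Ico.mp (hA ha); omega] at h1
    omega

lemma hitCount_lt_card (A P : Finset ℕ) (hA : 0 < A.card) : hitCount A P < A.card := by
  calc hitCount A P ≤ (Finset.Ioo 0 A.card).card := Finset.card_le_card Finset.inter_subset_right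
    _ < A.card := by rw [Nat.card_Ioo]; omega

lemma exists_subset_le_hitCount {A P : Finset ℕ} {j : ℕ} (h : j ≤ hitCount A P) :
    ∃ Q ⊆ P, Q.card = j ∧ j ≤ hitCount A Q := by
  obtain ⟨V, hV, hVc⟩ := Finset.exists_subset_card_eq h
  have hVP : V ⊆ P.image (cutRank A) := hV.trans Finset.inter_subset_left
  obtain ⟨Q, hQP, hinj, hQV⟩ := Finset.exists_subset_injOn_image_eq_of_surjOn (f := cutRank A)
    (s := P) (t := V) (by
      intro v hv
      have := hVP hv
      simpa using this)
  refine ⟨Q, by exact_mod_cast hQP, ?_, ?_⟩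
  · rw [← hVc, ← hQV, Finset.card_image_of_injOn hinj]
  · unfold hitCount
    rw [hQV, Finset.inter_eq_left.mpr (hV.trans Finset.inter_subset_right), hVc]

lemma exists_sparse_window (Z : Finset (Finset ℕ)) (s t N : ℕ) (hN : 0 < N) :
    ∃ i < N, N * (Z.filter fun P => P.Nonempty ∧
      P ⊆ Finset.Ico (s + i * t) (s + (i + 1) * t)).card ≤ Z.card := by
  classical
  set W : ℕ → Finset (Finset ℕ) := fun i => Z.filter fun P => P.Nonempty ∧
      P ⊆ Finset.Ico (s + i * t) (s + (i + 1) * t) with hW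
  have hdisj : ∀ i ∈ Finset.range N, ∀ i' ∈ Finset.range N, i ≠ i' → Disjoint (W i) (W i') := by
    intro i _ i' _ hii
    rw [Finset.disjoint_left]
    intro P hP hP'
    simp only [hW, Finset.mem_filter] at hP hP'
    obtain ⟨x, hx⟩ := hP.2.1
    have h1 := Finset.mem_Ico.mp (hP.2.2 hx)
    have h2 := Finset.mem_Ico.mp (hP'.2.2 hx)
    rcases lt_or_gt_of_ne hii with h | h
    · have := Nat.mul_le_mul_right t (show i + 1 ≤ i' from h); omega
    · have := Nat.mul_le_mul_right t (show i' + 1 ≤ i from h); omega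
  have hsum : ∑ i ∈ Finset.range N, (W i).card ≤ Z.card := by
    rw [← Finset.card_biUnion hdisj]
    exact Finset.card_le_card (Finset.biUnion_subset.mpr fun i _ => Finset.filter_subset _ _)
  by_contra! hcon
  have hlt : ∑ i ∈ Finset.range N, Z.card < ∑ i ∈ Finset.range N, N * (W i).card :=
    Finset.sum_lt_sum_of_nonempty (by simpa using hN.ne') fun i hi =>
      hcon i (Finset.mem_range.mp hi)
  rw [← Finset.mul_sum, Finset.sum_const, Finset.card_range, smul_eq_mul] at hlt
  have := Nat.mul_le_mul_left N hsum
  omega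

lemma LeavesUnstabbed.mul {j κ c n : ℕ} (hj : 0 < j) (h : LeavesUnstabbed j κ c n) (q : ℕ)
    (hq : 0 < q) : LeavesUnstabbed j κ c (q * n) := by
  classical
  intro s Z hZ hcard
  obtain ⟨i, hi, hiZ⟩ := exists_sparse_window Z s n q hq
  obtain ⟨A, hA, hAκ, hAZ⟩ := h (s + i * n) (Z.filter fun P => P.Nonempty ∧
      P ⊆ Finset.Ico (s + i * n) (s + (i + 1) * n))
    (fun P hP => hZ P (Finset.mem_filter.mp hP).1)
    (by
      refine Nat.le_of_mul_le_mul_left ?_ hq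
      calc _ ≤ Z.card := hiZ
        _ ≤ c * (q * n) := hcard
        _ = q * (c * n) := by ring)
  have hend : s + (i + 1) * n = s + i * n + n := by ring
  refine ⟨A, hA.trans ?_, hAκ, fun P hP => ?_⟩
  · have := Nat.mul_le_mul_right n (show i + 1 ≤ q from hi)
    exact Finset.Ico_subset_Ico (by omega) (by omega)
  · rcases P.eq_empty_or_nonempty with rfl | hne
    · simpa [hitCount] using hj
    by_cases hPs : P ⊆ Finset.Ico (s + i * n) (s + (i + 1) * n)
    · exact hAZ P (Finset.mem_filter.mpr ⟨hP, hne, hPs⟩)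
    · exact hitCount_lt_of_not_subset hA (hZ P hP) (by rwa [hend] at hPs)

lemma cutRank_biUnion {a : Finset ℕ} {C : ℕ → Finset ℕ}
    (hC : (a : Set ℕ).PairwiseDisjoint C) (x : ℕ) :
    cutRank (a.biUnion C) x = ∑ y ∈ a, cutRank (C y) x := by
  classical
  unfold cutRank
  rw [Finset.filter_biUnion, Finset.card_biUnion]
  intro y hy y' hy' hne
  exact Finset.disjoint_filter_filter (hC hy hy' hne)

lemma hitCount_biUnion_le {a P : Finset ℕ} {C : ℕ → Finset ℕ} {φ : ℕ → ℕ}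
    (hC : (a : Set ℕ).PairwiseDisjoint C)
    (hφ : ∀ x ∈ P, ∀ y ∈ a, cutRank (C y) x = if y ≤ φ x then (C y).card else 0) :
    hitCount (a.biUnion C) P ≤ hitCount a (P.image φ) := by
  classical
  set H : ℕ → ℕ := fun r => ∑ y ∈ a with cutRank a y ≤ r, (C y).card with hH
  have hrank : ∀ x ∈ P, cutRank (a.biUnion C) x = H (cutRank a (φ x)) := by
    intro x hx
    rw [cutRank_biUnion hC, Finset.sum_congr rfl (hφ x hx), ← Finset.sum_filter]
    refine Finset.sum_congr (Finset.filter_congr fun y hy => ?_) fun _ _ => rfl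
    constructor
    · exact fun h => cutRank_mono a h
    · intro h
      by_contra! hlt
      exact absurd (cutRank_lt_cutRank hy hlt le_rfl) (by omega)
  have hH0 : H 0 = 0 := by
    refine Finset.sum_eq_zero fun y hy => ?_
    obtain ⟨hy, hy0⟩ := Finset.mem_filter.mp hy
    have : 0 < cutRank a y := Finset.card_pos.mpr ⟨y, by simp [hy]⟩
    omega
  have hHtop : H a.card = (a.biUnion C).card := by
    rw [Finset.card_biUnion (fun y hy y' hy' hne => hC hy hy' hne)]
    exact Finset.sum_congr (Finset.filter_true_of_mem fun y _ => cutRank_le_card a y)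
      fun _ _ => rfl
  refine (Finset.card_le_card (t := (((P.image φ).image (cutRank a)) ∩
    Finset.Ioo 0 a.card).image H) ?_).trans Finset.card_image_le
  intro v hv
  simp only [Finset.mem_inter, Finset.mem_image, Finset.mem_Ioo] at hv
  obtain ⟨⟨x, hx, rfl⟩, h0, h1⟩ := hv
  rw [hrank x hx] at h0 h1 ⊢
  refine Finset.mem_image_of_mem _ (Finset.mem_inter.mpr
    ⟨Finset.mem_image_of_mem _ (Finset.mem_image_of_mem _ hx), Finset.mem_Ioo.mpr ⟨?_, ?_⟩⟩)
  · rcases Nat.eq_zero_or_pos (cutRank a (φ x)) with h | h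
    · rw [h, hH0] at h0; omega
    · exact h
  · refine lt_of_le_of_ne (cutRank_le_card _ _) fun h => ?_
    rw [h, hHtop] at h1; omega

lemma hitCount_le_of_cutRank_eq_add {A C P : Finset ℕ} {K : ℕ}
    (h : ∀ x ∈ P, cutRank A x = K + cutRank C x) : hitCount A P ≤ hitCount C P + 2 := by
  classical
  have hsub : (P.image (cutRank A)) ∩ Finset.Ioo 0 A.card ⊆
      (((P.image (cutRank C)) ∩ Finset.Ioo 0 C.card) ∪ {0, C.card}).image (K + ·) := by
    intro v hv
    simp only [Finset.mem_inter, Finset.mem_image, Finset.mem_Ioo] at hv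
    obtain ⟨⟨x, hx, rfl⟩, h0, h1⟩ := hv
    rw [h x hx]
    refine Finset.mem_image_of_mem _ ?_
    have := cutRank_le_card C x
    simp only [Finset.mem_union, Finset.mem_inter, Finset.mem_image, Finset.mem_Ioo,
      Finset.mem_insert, Finset.mem_singleton]
    by_cases h2 : cutRank C x = 0
    · simp [h2]
    by_cases h3 : cutRank C x = C.card
    · simp [h3]
    exact Or.inl ⟨⟨x, hx, rfl⟩, by omega, by omega⟩
  calc hitCount A P ≤ _ := (Finset.card_le_card hsub).trans Finset.card_image_le
    _ ≤ _ := (Finset.card_union_le _ _).trans (Nat.add_le_add_left Finset.card_le_two _)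

lemma hitCount_le_of_cutRank_eq {A C P : Finset ℕ}
    (h : ∀ x ∈ P, cutRank A x = cutRank C x) : hitCount A P ≤ hitCount C P + 1 := by
  classical
  have hsub : (P.image (cutRank A)) ∩ Finset.Ioo 0 A.card ⊆
      (((P.image (cutRank C)) ∩ Finset.Ioo 0 C.card) ∪ {C.card}) := by
    intro v hv
    simp only [Finset.mem_inter, Finset.mem_image, Finset.mem_Ioo] at hv
    obtain ⟨⟨x, hx, rfl⟩, h0, h1⟩ := hv
    rw [h x hx] at h0 ⊢
    have := cutRank_le_card C x
    simp only [Finset.mem_union, Finset.mem_inter, Finset.mem_image, Finset.mem_Ioo,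
      Finset.mem_singleton]
    by_cases h3 : cutRank C x = C.card
    · simp [h3]
    exact Or.inl ⟨⟨x, hx, rfl⟩, by omega, by omega⟩
  calc hitCount A P ≤ _ := Finset.card_le_card hsub
    _ ≤ _ := (Finset.card_union_le _ _).trans (by simp [hitCount])

lemma exists_good_windows {j u v M L s : ℕ} {Z G : Finset (Finset ℕ)} (hu : 0 < u) (hv : 0 < v)
    (hZ : ∀ P ∈ Z, P.card ≤ j) (hGZ : G ⊆ Z)
    (hG : 4 * j * u * G.card ≤ u * v * (2 * M))
    (hL : 4 * j * u * Z.card ≤ L * (u * v * (2 * M))) :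
    ∃ w : ℕ → ℕ, StrictMonoOn (fun y => w y / v) (Set.Icc 1 M) ∧
      ∀ y ∈ Set.Icc 1 M, w y < v * (2 * M) ∧
        (∀ P ∈ G, ∀ x ∈ P, x ∉ Finset.Ico (s + w y * u) (s + w y * u + u)) ∧
        (Z.filter fun P => ∃ x ∈ P, x ∈ Finset.Ico (s + w y * u) (s + w y * u + u)).card ≤ L := by
  classical
  set W : ℕ → Finset ℕ := fun w => Finset.Ico (s + w * u) (s + w * u + u) with hW
  have hWmem : ∀ w x, x ∈ W w → (x - s) / u = w := by
    intro w x hx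
    simp only [hW, Finset.mem_Ico] at hx
    refine Nat.div_eq_of_lt_le ?_ ?_
    · omega
    · rw [Nat.succ_mul]; omega
  set R := Finset.range (v * (2 * M)) with hR
  set bad₁ := R.filter fun w => ∃ P ∈ G, ∃ x ∈ P, x ∈ W w with hbad₁
  set bad₂ := R.filter fun w => L < (Z.filter fun P => ∃ x ∈ P, x ∈ W w).card with hbad₂
  have hfib : ∀ P : Finset ℕ, (R.filter fun w => ∃ x ∈ P, x ∈ W w).card ≤ P.card := by
    intro P
    refine (Finset.card_le_card (t := P.image fun x => (x - s) / u) ?_).trans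
      Finset.card_image_le
    intro w hw
    obtain ⟨_, x, hx, hxw⟩ := Finset.mem_filter.mp hw
    exact Finset.mem_image.mpr ⟨x, hx, hWmem w x hxw⟩
  have h₁ : 4 * bad₁.card ≤ v * (2 * M) := by
    have : bad₁ ⊆ G.biUnion fun P => R.filter fun w => ∃ x ∈ P, x ∈ W w := by
      intro w hw
      obtain ⟨hwR, P, hP, hx⟩ := Finset.mem_filter.mp hw
      exact Finset.mem_biUnion.mpr ⟨P, hP, Finset.mem_filter.mpr ⟨hwR, hx⟩⟩
    have hle : bad₁.card ≤ G.card * j :=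
      (Finset.card_le_card this).trans (Finset.card_biUnion_le_card_mul _ _ _ fun P hP =>
        (hfib P).trans (hZ P (hGZ hP)))
    refine Nat.le_of_mul_le_mul_left ?_ hu
    calc u * (4 * bad₁.card) ≤ u * (4 * (G.card * j)) := by gcongr
      _ = 4 * j * u * G.card := by ring
      _ ≤ u * v * (2 * M) := hG
      _ = u * (v * (2 * M)) := by ring
  have h₂ : 4 * bad₂.card ≤ v * (2 * M) := by
    have hcount : bad₂.card * (L + 1) ≤ Z.card * j := by
      calc bad₂.card * (L + 1)
          ≤ ∑ w ∈ bad₂, (Z.filter fun P => ∃ x ∈ P, x ∈ W w).card := by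
            rw [← smul_eq_mul]
            exact Finset.card_nsmul_le_sum _ _ _ fun w hw => (Finset.mem_filter.mp hw).2
        _ ≤ ∑ w ∈ R, (Z.filter fun P => ∃ x ∈ P, x ∈ W w).card :=
            Finset.sum_le_sum_of_subset (Finset.filter_subset _ _)
        _ = ∑ P ∈ Z, (R.filter fun w => ∃ x ∈ P, x ∈ W w).card :=
            Finset.sum_card_bipartiteAbove_eq_sum_card_bipartiteBelow
              (fun w P => ∃ x ∈ P, x ∈ W w)
        _ ≤ Z.card * j := by
            rw [← smul_eq_mul]
            exact Finset.sum_le_card_nsmul _ _ _ fun P hP => (hfib P).trans (hZ P hP)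
    have hpos : 0 < u * (L + 1) := Nat.mul_pos hu (Nat.succ_pos L)
    refine Nat.le_of_mul_le_mul_left ?_ hpos
    calc u * (L + 1) * (4 * bad₂.card) = 4 * u * (bad₂.card * (L + 1)) := by ring
      _ ≤ 4 * u * (Z.card * j) := by gcongr
      _ = 4 * j * u * Z.card := by ring
      _ ≤ L * (u * v * (2 * M)) := hL
      _ ≤ (L + 1) * (u * v * (2 * M)) := by gcongr; omega
      _ = u * (L + 1) * (v * (2 * M)) := by ring
  set good := (Finset.range (2 * M)).filter fun β => ∃ w ∈ R, w / v = β ∧ w ∉ bad₁ ∧ w ∉ bad₂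
    with hgood
  have hgoodcard : M ≤ good.card := by
    set B := (Finset.range (2 * M)).filter fun β => ¬ ∃ w ∈ R, w / v = β ∧ w ∉ bad₁ ∧ w ∉ bad₂
      with hB
    have hsum : good.card + B.card = 2 * M := by
      rw [hgood, hB, Finset.card_filter_add_card_filter_not, Finset.card_range]
    have hinj : (B ×ˢ Finset.range v).card ≤ (bad₁ ∪ bad₂).card := by
      refine Finset.card_le_card_of_injOn (fun p => p.1 * v + p.2) ?_ ?_
      · rintro ⟨β, i⟩ hp
        simp only [Finset.coe_product, Set.mem_prod, Finset.mem_coe, Finset.mem_range] at hp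
        obtain ⟨hβ, hi⟩ := hp
        obtain ⟨hβM, hβ⟩ := Finset.mem_filter.mp hβ
        rw [Finset.mem_range] at hβM
        push Not at hβ
        have hdiv : (β * v + i) / v = β := by
          rw [Nat.mul_comm, Nat.mul_add_div hv, Nat.div_eq_of_lt hi, add_zero]
        have hlt : β * v + i ∈ R := by
          have := Nat.mul_le_mul_right v (show β + 1 ≤ 2 * M from hβM)
          rw [hR, Finset.mem_range, Nat.mul_comm v]
          rw [Nat.succ_mul] at this
          omega
        simp only [Finset.coe_union, Set.mem_union, Finset.mem_coe]
        by_cases h : β * v + i ∈ bad₁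
        · exact Or.inl h
        · exact Or.inr (hβ _ hlt hdiv h)
      · rintro ⟨β, i⟩ hp ⟨β', i'⟩ hp' heq
        simp only [Finset.coe_product, Set.mem_prod, Finset.mem_coe, Finset.mem_range] at hp hp'
        simp only at heq
        have e1 : (β * v + i) / v = β := by
          rw [Nat.mul_comm, Nat.mul_add_div hv, Nat.div_eq_of_lt hp.2, add_zero]
        have e2 : (β' * v + i') / v = β' := by
          rw [Nat.mul_comm, Nat.mul_add_div hv, Nat.div_eq_of_lt hp'.2, add_zero]
        have : β = β' := by rw [← e1, ← e2, heq]
        subst this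
        simp only [Prod.mk.injEq, true_and]
        omega
    rw [Finset.card_product, Finset.card_range] at hinj
    have hun := Finset.card_union_le bad₁ bad₂
    have : v * B.card ≤ v * M := by
      have e : v * (2 * M) = 2 * (v * M) := by ring
      rw [e] at h₁ h₂
      rw [Nat.mul_comm v]
      omega
    have := Nat.le_of_mul_le_mul_left this hv
    omega
  have hchoose : ∀ β ∈ good, ∃ w ∈ R, w / v = β ∧ w ∉ bad₁ ∧ w ∉ bad₂ :=
    fun β hβ => (Finset.mem_filter.mp hβ).2
  choose! w hwR hwv hw₁ hw₂ using hchoose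
  set e := good.orderEmbOfCardLe hgoodcard
  have he : ∀ i, e i ∈ good := Finset.orderEmbOfCardLe_mem good hgoodcard
  refine ⟨fun y => if h : y - 1 < M then w (e ⟨y - 1, h⟩) else 0, ?_, ?_⟩
  · rintro y ⟨hy1, hyM⟩ y' ⟨hy1', hyM'⟩ hlt
    have h : y - 1 < M := by omega
    have h' : y' - 1 < M := by omega
    simp only [h, h', dif_pos, hwv _ (he _)]
    exact e.strictMono (by rw [Fin.mk_lt_mk]; omega)
  · rintro y ⟨hy1, hyM⟩
    have h : y - 1 < M := by omega
    simp only [h, dif_pos]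
    have hmem := he ⟨y - 1, h⟩
    have hR' := hwR _ hmem
    refine ⟨Finset.mem_range.mp hR', fun P hP x hx hxW => ?_, ?_⟩
    · exact hw₁ _ hmem (Finset.mem_filter.mpr ⟨hR', P, hP, x, hx, hxW⟩)
    · by_contra! hlt
      exact hw₂ _ hmem (Finset.mem_filter.mpr ⟨hR', hlt⟩)

/-- Counting the points of a strictly increasing sequence below `x` inverts the sequence. -/
lemma le_card_filter_iff {st : ℕ → ℕ} {M : ℕ} (hst : StrictMonoOn st (Set.Icc 1 M)) {y : ℕ}
    (hy : y ∈ Set.Icc 1 M) (x : ℕ) :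
    st y ≤ x ↔ y ≤ ((Finset.Icc 1 M).filter fun i => st i ≤ x).card := by
  obtain ⟨hy1, hyM⟩ := hy
  constructor
  · intro h
    calc y = (Finset.Icc 1 y).card := by simp
      _ ≤ _ := by
        refine Finset.card_le_card fun i hi => ?_
        obtain ⟨hi1, hiy⟩ := Finset.mem_Icc.mp hi
        exact Finset.mem_filter.mpr ⟨Finset.mem_Icc.mpr ⟨hi1, hiy.trans hyM⟩,
          (hst.monotoneOn ⟨hi1, hiy.trans hyM⟩ ⟨hy1, hyM⟩ hiy).trans h⟩
  · intro h
    by_contra! hlt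
    have : ((Finset.Icc 1 M).filter fun i => st i ≤ x) ⊆ Finset.Icc 1 (y - 1) := by
      intro i hi
      obtain ⟨hiM, hix⟩ := Finset.mem_filter.mp hi
      obtain ⟨hi1, hiM⟩ := Finset.mem_Icc.mp hiM
      refine Finset.mem_Icc.mpr ⟨hi1, ?_⟩
      by_contra! hge
      have := hst.monotoneOn ⟨hy1, hyM⟩ ⟨hi1, hiM⟩ (show y ≤ i by omega)
      omega
    have := Finset.card_le_card this
    rw [Nat.card_Icc] at this
    omega

/-- Any `L` sets of at most `j` points leave, in every window of length `u`, some set of `κ` cuts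
of whose gaps they meet fewer than `j - e`. -/
def LeavesSlack (j e κ L u : ℕ) : Prop :=
  ∀ (s : ℕ) (Z : Finset (Finset ℕ)), (∀ P ∈ Z, P.card ≤ j) → Z.card ≤ L →
    ∃ A ⊆ Finset.Ico s (s + u), A.card = κ ∧ ∀ P ∈ Z, hitCount A P + e < j

lemma LeavesSlack.mono {j e κ L L' u : ℕ} (h : LeavesSlack j e κ L u) (hL : L' ≤ L) :
    LeavesSlack j e κ L' u :=
  fun s Z hZ hc => h s Z hZ (hc.trans hL)

lemma LeavesSlack.le {j e κ L u : ℕ} (h : LeavesSlack j e κ L u) : κ ≤ u := by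
  obtain ⟨A, hA, hc, -⟩ := h 0 ∅ (by simp) (by simp)
  simpa [hc] using Finset.card_le_card hA

lemma LeavesUnstabbed.le {j κ c n : ℕ} (h : LeavesUnstabbed j κ c n) : κ ≤ n := by
  obtain ⟨A, hA, hc, -⟩ := h 0 ∅ (by simp) (by simp)
  simpa [hc] using Finset.card_le_card hA

lemma LeavesSlack.exists_of_filter {j e κ L u s : ℕ} (h : LeavesSlack j e κ L u) (he : e < j)
    {Z : Finset (Finset ℕ)} (hZ : ∀ P ∈ Z, P.card ≤ j)
    (hL : (Z.filter fun P => ∃ x ∈ P, x ∈ Finset.Ico s (s + u)).card ≤ L) :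
    ∃ A ⊆ Finset.Ico s (s + u), A.card = κ ∧ ∀ P ∈ Z, hitCount A P + e < j := by
  obtain ⟨A, hA, hc, hhit⟩ := h s _ (fun P hP => hZ P (Finset.mem_filter.mp hP).1) hL
  refine ⟨A, hA, hc, fun P hP => ?_⟩
  by_cases hx : ∃ x ∈ P, x ∈ Finset.Ico s (s + u)
  · exact hhit P (Finset.mem_filter.mpr ⟨hP, hx⟩)
  · push Not at hx
    rw [hitCount_eq_zero_of_disjoint hA hx]
    omega

lemma exists_unstabbed_of_windows {j u v M L s κ₀ κ₁ κ₂ : ℕ} {Z G : Finset (Finset ℕ)}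
    {w : ℕ → ℕ} (hj : 3 ≤ j) (hv : 0 < v) (hκ₁ : 0 < κ₁) (hZ : ∀ P ∈ Z, P.card ≤ j)
    (hGZ : G ⊆ Z) (hGc : G.card ≤ u * v * M)
    (hloc : ∀ P ∈ Z, P ∉ G → ∃ β, P ⊆ Finset.Ico (s + β * (u * v)) (s + (β + 1) * (u * v)))
    (h₀ : LeavesSlack j 1 κ₀ L u) (h₂ : LeavesSlack j 2 κ₂ L u)
    (h₁ : LeavesUnstabbed j κ₁ (u * v) M)
    (hwm : StrictMonoOn (fun y => w y / v) (Set.Icc 1 M))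
    (hwlt : ∀ y ∈ Set.Icc 1 M, w y < v * (2 * M))
    (hwG : ∀ y ∈ Set.Icc 1 M, ∀ P ∈ G, ∀ x ∈ P,
      x ∉ Finset.Ico (s + w y * u) (s + w y * u + u))
    (hwL : ∀ y ∈ Set.Icc 1 M,
      (Z.filter fun P => ∃ x ∈ P, x ∈ Finset.Ico (s + w y * u) (s + w y * u + u)).card ≤ L) :
    ∃ A ⊆ Finset.Ico s (s + u * v * (2 * M)), A.card = κ₀ + (κ₁ - 1) * κ₂ ∧
      ∀ P ∈ Z, hitCount A P < j := by
  classical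
  set st : ℕ → ℕ := fun y => s + w y * u with hst
  set φ : ℕ → ℕ := fun x => ((Finset.Icc 1 M).filter fun i => st i ≤ x).card with hφ
  have hu : 0 < u ∨ u = 0 := by omega
  -- windows in distinct blocks are separated by block boundaries
  have hlo : ∀ y, s + w y / v * (u * v) ≤ st y := by
    intro y
    have : w y / v * v ≤ w y := Nat.div_mul_le_self _ _
    calc s + w y / v * (u * v) = s + (w y / v * v) * u := by ring
      _ ≤ s + w y * u := by gcongr
  have hhi : ∀ y, st y + u ≤ s + (w y / v + 1) * (u * v) := by
    intro y
    have : w y + 1 ≤ (w y / v + 1) * v := by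
      have := Nat.lt_div_mul_add (a := w y) hv
      rw [Nat.succ_mul]; omega
    calc st y + u = s + (w y + 1) * u := by simp only [hst]; ring
      _ ≤ s + ((w y / v + 1) * v) * u := by gcongr
      _ = s + (w y / v + 1) * (u * v) := by ring
  have hsep : ∀ y y', w y / v < w y' / v → st y + u ≤ st y' := by
    intro y y' h
    refine (hhi y).trans (le_trans ?_ (hlo y'))
    have : (w y / v + 1) * (u * v) ≤ w y' / v * (u * v) := Nat.mul_le_mul_right _ h
    omega
  have hstu : ∀ y ∈ Set.Icc 1 M, ∀ y' ∈ Set.Icc 1 M, y < y' → st y + u ≤ st y' :=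
    fun y hy y' hy' h => hsep y y' (hwm hy hy' h)
  obtain ⟨a, ha, hac, haG⟩ := h₁ 1 (G.image fun P => P.image φ)
    (by
      intro Q hQ
      obtain ⟨P, hP, rfl⟩ := Finset.mem_image.mp hQ
      exact Finset.card_image_le.trans (hZ P (hGZ hP)))
    (Finset.card_image_le.trans hGc)
  have haM : ∀ y ∈ a, y ∈ Set.Icc 1 M := by
    intro y hy
    have := Finset.mem_Ico.mp (ha hy)
    exact ⟨this.1, by omega⟩
  have hane : a.Nonempty := by rw [← Finset.card_pos]; omega
  set y₀ := a.min' hane with hy₀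
  have hy₀a : y₀ ∈ a := Finset.min'_mem _ _
  have hCex : ∀ y ∈ a, ∃ C ⊆ Finset.Ico (st y) (st y + u),
      C.card = (if y = y₀ then κ₀ else κ₂) ∧
      ∀ P ∈ Z, hitCount C P + (if y = y₀ then 1 else 2) < j := by
    intro y hy
    by_cases h : y = y₀
    · simp only [h, if_true]
      exact h₀.exists_of_filter (by omega) hZ (hwL y₀ (haM _ hy₀a))
    · simp only [h, if_false]
      exact h₂.exists_of_filter (by omega) hZ (hwL y (haM _ hy))
  choose! C hCsub hCcard hCZ using hCex
  have hCmem : ∀ y ∈ a, ∀ b ∈ C y, st y ≤ b ∧ b < st y + u := fun y hy b hb =>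
    Finset.mem_Ico.mp (hCsub y hy hb)
  have hCdisj : (a : Set ℕ).PairwiseDisjoint C := by
    intro y hy y' hy' hne
    rw [Function.onFun, Finset.disjoint_left]
    intro b hb hb'
    have h1 := hCmem y hy b hb
    have h2 := hCmem y' hy' b hb'
    rcases lt_or_gt_of_ne hne with h | h
    · have := hstu y (haM y hy) y' (haM y' hy') h; omega
    · have := hstu y' (haM y' hy') y (haM y hy) h; omega
  refine ⟨a.biUnion C, ?_, ?_, ?_⟩
  · intro b hb
    obtain ⟨y, hy, hb⟩ := Finset.mem_biUnion.mp hb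
    have h1 := hCmem y hy b hb
    have h2 : st y + u ≤ s + u * v * (2 * M) := by
      calc st y + u = s + (w y + 1) * u := by simp only [hst]; ring
        _ ≤ s + (v * (2 * M)) * u := by gcongr; exact hwlt y (haM y hy)
        _ = _ := by ring
    rw [Finset.mem_Ico]
    simp only [hst] at h1 h2
    omega
  · rw [Finset.card_biUnion fun y hy y' hy' hne => hCdisj hy hy' hne,
      ← Finset.add_sum_erase a _ hy₀a, hCcard y₀ hy₀a, if_pos rfl]
    congr 1
    rw [Finset.sum_congr rfl (g := fun _ => κ₂) fun y hy => by
      obtain ⟨hne, hy⟩ := Finset.mem_erase.mp hy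
      rw [hCcard y hy, if_neg hne]]
    rw [Finset.sum_const, Finset.card_erase_of_mem hy₀a, hac, smul_eq_mul]
  · intro P hP
    by_cases hPG : P ∈ G
    · refine lt_of_le_of_lt (hitCount_biUnion_le (φ := φ) hCdisj ?_)
        (haG _ (Finset.mem_image_of_mem _ hPG))
      intro x hx y hy
      have hxw := hwG y (haM y hy) P hPG x hx
      rcases hu with hu | hu
      · have hmono : StrictMonoOn st (Set.Icc 1 M) := fun y hy y' hy' h => by
          have := hstu y hy y' hy' h; omega
        have hiff := le_card_filter_iff hmono (haM y hy) x
        by_cases hle : st y ≤ x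
        · rw [if_pos (hiff.mp hle)]
          refine cutRank_eq_card fun b hb => ?_
          have := hCmem y hy b hb
          rw [Finset.mem_Ico] at hxw
          simp only [hst] at *
          omega
        · rw [if_neg (fun h => hle (hiff.mpr h))]
          refine cutRank_eq_zero fun b hb => ?_
          have := hCmem y hy b hb
          omega
      · have : C y = ∅ := by
          rw [Finset.eq_empty_iff_forall_notMem]
          intro b hb
          have := hCmem y hy b hb
          omega
        simp [this, cutRank]
    · obtain ⟨β, hβ⟩ := hloc P hP hPG
      have hPβ : ∀ x ∈ P, s + β * (u * v) ≤ x ∧ x < s + (β + 1) * (u * v) :=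
        fun x hx => Finset.mem_Ico.mp (hβ hx)
      have hbelow : ∀ x ∈ P, ∀ y ∈ a, w y / v < β → cutRank (C y) x = (C y).card := by
        intro x hx y hy hlt
        refine cutRank_eq_card fun b hb => ?_
        have h1 := hCmem y hy b hb
        have h2 := hhi y
        have h3 : (w y / v + 1) * (u * v) ≤ β * (u * v) := Nat.mul_le_mul_right _ hlt
        have h4 := hPβ x hx
        omega
      have habove : ∀ x ∈ P, ∀ y ∈ a, β < w y / v → cutRank (C y) x = 0 := by
        intro x hx y hy hlt
        refine cutRank_eq_zero fun b hb => ?_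
        have h1 := hCmem y hy b hb
        have h2 := hlo y
        have h3 : (β + 1) * (u * v) ≤ w y / v * (u * v) := Nat.mul_le_mul_right _ hlt
        have h4 := hPβ x hx
        omega
      by_cases hex : ∃ i ∈ a, w i / v = β
      · obtain ⟨i, hia, hi⟩ := hex
        have hrank : ∀ x ∈ P, cutRank (a.biUnion C) x =
            (∑ y ∈ a with y < i, (C y).card) + cutRank (C i) x := by
          intro x hx
          rw [cutRank_biUnion hCdisj, Finset.sum_filter, ← Finset.sum_erase_add _ _ hia,
            ← Finset.sum_erase_add (a := i) a _ hia, if_neg (lt_irrefl i), add_zero]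
          congr 1
          refine Finset.sum_congr rfl fun y hy => ?_
          obtain ⟨hne, hy⟩ := Finset.mem_erase.mp hy
          rcases lt_or_gt_of_ne hne with h | h
          · rw [if_pos h, hbelow x hx y hy (hi ▸ hwm (haM y hy) (haM i hia) h)]
          · rw [if_neg (not_lt.mpr h.le), habove x hx y hy (hi ▸ hwm (haM i hia) (haM y hy) h)]
        have hCi := hCZ i hia P hP
        by_cases hiy : i = y₀
        · rw [if_pos hiy] at hCi
          have : (∑ y ∈ a with y < i, (C y).card) = 0 := by
            rw [Finset.filter_false_of_mem, Finset.sum_empty]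
            intro y hy
            rw [hiy, not_lt]
            exact Finset.min'_le _ _ hy
          simp only [this, zero_add] at hrank
          have := hitCount_le_of_cutRank_eq hrank
          omega
        · rw [if_neg hiy] at hCi
          have := hitCount_le_of_cutRank_eq_add hrank
          omega
      · push Not at hex
        have hrank : ∀ x ∈ P, cutRank (a.biUnion C) x =
            (∑ y ∈ a with w y / v < β, (C y).card) + cutRank ∅ x := by
          intro x hx
          rw [cutRank_biUnion hCdisj, Finset.sum_filter]
          have h0 : cutRank ∅ x = 0 := cutRank_eq_zero (by simp)
          rw [h0, add_zero]
          refine Finset.sum_congr rfl fun y hy => ?_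
          rcases lt_or_gt_of_ne (hex y hy) with h | h
          · rw [if_pos h, hbelow x hx y hy h]
          · rw [if_neg (not_lt.mpr h.le), habove x hx y hy h]
        have h1 := hitCount_le_of_cutRank_eq_add hrank
        have h2 : hitCount ∅ P = 0 := by simp [hitCount]
        omega

/-- The window lengths of the iterated block construction. -/
def blockLength (f : ℕ → ℕ) (u L : ℕ) : ℕ := (fun T => 2 * T * f T)^[L + 1] u

lemma blockLength_zero (f : ℕ → ℕ) (u : ℕ) : blockLength f u 0 = 2 * u * f u := rfl

lemma blockLength_succ (f : ℕ → ℕ) (u L : ℕ) :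
    blockLength f u (L + 1) = 2 * blockLength f u L * f (blockLength f u L) := by
  simp only [blockLength]
  rw [Function.iterate_succ_apply']

lemma dvd_blockLength (f : ℕ → ℕ) (u L : ℕ) : u ∣ blockLength f u L := by
  induction L with
  | zero => exact ⟨2 * f u, by rw [blockLength_zero]; ring⟩
  | succ L ih =>
    rw [blockLength_succ]
    exact (ih.mul_left 2).mul_right _

lemma exists_unstabbed_blockLength {j u κ₀ κ₁ κ₂ Lm : ℕ} {f : ℕ → ℕ} (hj : 3 ≤ j) (hu : 0 < u)
    (hκ₁ : 0 < κ₁) (h₀ : LeavesSlack j 1 κ₀ Lm u) (h₂ : LeavesSlack j 2 κ₂ Lm u)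
    (h₁ : ∀ c, 0 < c → LeavesUnstabbed j κ₁ c (f c)) (L : ℕ) (hL : L ≤ Lm) :
    0 < blockLength f u L ∧ ∀ (s : ℕ) (Z : Finset (Finset ℕ)), (∀ P ∈ Z, P.card ≤ j) →
      4 * j * u * Z.card ≤ L * blockLength f u L →
      ∃ A ⊆ Finset.Ico s (s + blockLength f u L), A.card = κ₀ + (κ₁ - 1) * κ₂ ∧
        ∀ P ∈ Z, hitCount A P < j := by
  classical
  have hf : ∀ c, 0 < c → 0 < f c := fun c hc => hκ₁.trans_le (h₁ c hc).le
  induction L with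
  | zero =>
    rw [blockLength_zero]
    refine ⟨Nat.mul_pos (by omega) (hf u hu), fun s Z _ hcard => ?_⟩
    have hZ0 : Z = ∅ := by
      rw [zero_mul, Nat.le_zero, Nat.mul_eq_zero] at hcard
      rcases hcard with h | h
      · have : 0 < 4 * j * u := by positivity
        omega
      · exact Finset.card_eq_zero.mp h
    have hle : κ₀ + (κ₁ - 1) * κ₂ ≤ 2 * u * f u := by
      obtain ⟨k, rfl⟩ : ∃ k, κ₁ = k + 1 := ⟨κ₁ - 1, by omega⟩
      calc κ₀ + (k + 1 - 1) * κ₂ ≤ u + k * u := by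
            gcongr
            · exact h₀.le
            · omega
            · exact h₂.le
        _ = u * (k + 1) := by ring
        _ ≤ u * f u := by gcongr; exact (h₁ u hu).le
        _ ≤ 2 * u * f u := by rw [mul_assoc]; omega
    refine ⟨Finset.Ico s (s + (κ₀ + (κ₁ - 1) * κ₂)), Finset.Ico_subset_Ico_right (by omega),
      by simp, by simp [hZ0]⟩
  | succ L ih =>
    obtain ⟨hpos, ih⟩ := ih (by omega)
    set t := blockLength f u L with ht
    obtain ⟨v, hv⟩ := dvd_blockLength f u L
    rw [← ht] at hv
    have hvpos : 0 < v := by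
      rcases Nat.eq_zero_or_pos v with h | h
      · rw [h] at hv; omega
      · exact h
    set M := f t with hM
    have hn : blockLength f u (L + 1) = t * (2 * M) := by rw [blockLength_succ]; ring
    have hMpos : 0 < M := hf t hpos
    rw [hn]
    refine ⟨by positivity, fun s Z hZ hcard => ?_⟩
    set G := Z.filter fun P => ¬ ∃ β, P ⊆ Finset.Ico (s + β * t) (s + (β + 1) * t) with hG
    have hGZ : G ⊆ Z := Finset.filter_subset _ _
    by_cases hGc : 4 * j * u * G.card ≤ t * (2 * M)
    · obtain ⟨w, hwm, hw⟩ := exists_good_windows (s := s) (L := L + 1) (M := M) hu hvpos hZ hGZ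
        (by rwa [← hv]) (by rwa [← hv])
      obtain ⟨A, hA, hAc, hAZ⟩ := exists_unstabbed_of_windows (L := L + 1) (κ₀ := κ₀)
        (κ₁ := κ₁) (κ₂ := κ₂) (w := w) hj hvpos hκ₁ hZ hGZ
        (by
          rw [← hv]
          have h1 : G.card * 2 ≤ 4 * j * u * G.card := by
            rw [Nat.mul_comm]
            refine Nat.mul_le_mul_right _ ?_
            nlinarith
          have h2 : t * (2 * M) = t * M * 2 := by ring
          omega)
        (by
          intro P hP hPG
          by_contra hne
          exact hPG (Finset.mem_filter.mpr ⟨hP, by rwa [← hv] at hne⟩))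
        (h₀.mono hL) (h₂.mono hL) (by rw [← hv]; exact h₁ t hpos) hwm
        (fun y hy => (hw y hy).1) (fun y hy => (hw y hy).2.1) (fun y hy => (hw y hy).2.2)
      rw [← hv] at hA
      exact ⟨A, hA, hAc, hAZ⟩
    · push Not at hGc
      set H := Z.filter fun P => ∃ β, P ⊆ Finset.Ico (s + β * t) (s + (β + 1) * t) with hH
      have hsum : H.card + G.card = Z.card := Finset.card_filter_add_card_filter_not _
      have hHc : 4 * j * u * H.card ≤ L * (t * (2 * M)) := by
        have h1 : 4 * j * u * H.card + 4 * j * u * G.card ≤ L * (t * (2 * M)) + t * (2 * M) := by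
          rw [← mul_add, hsum]
          linarith
        omega
      obtain ⟨i, hi, hiH⟩ := exists_sparse_window H s t (2 * M) (by omega)
      set B := H.filter fun P => P.Nonempty ∧ P ⊆ Finset.Ico (s + i * t) (s + (i + 1) * t) with hB
      have hend : s + (i + 1) * t = s + i * t + t := by ring
      have hend' : s + (i + 1) * t ≤ s + t * (2 * M) := by
        have := Nat.mul_le_mul_right t (show i + 1 ≤ 2 * M from hi)
        rw [Nat.mul_comm t]
        omega
      obtain ⟨A, hA, hAc, hAB⟩ := ih (s + i * t) B
        (fun P hP => hZ P (Finset.mem_filter.mp (Finset.mem_filter.mp hP).1).1) (by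
          refine Nat.le_of_mul_le_mul_left ?_ (show 0 < 2 * M by omega)
          calc 2 * M * (4 * j * u * B.card) = 4 * j * u * (2 * M * B.card) := by ring
            _ ≤ 4 * j * u * H.card := by gcongr
            _ ≤ L * (t * (2 * M)) := hHc
            _ = 2 * M * (L * t) := by ring)
      refine ⟨A, ?_, hAc, fun P hP => ?_⟩
      · refine hA.trans ?_
        rw [← hend]
        exact Finset.Ico_subset_Ico (by omega) hend'
      · by_cases hPi : P ⊆ Finset.Ico (s + i * t) (s + (i + 1) * t)
        · rcases P.eq_empty_or_nonempty with rfl | hne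
          · simp only [hitCount, Finset.image_empty, Finset.empty_inter, Finset.card_empty]
            omega
          · exact hAB P (Finset.mem_filter.mpr ⟨Finset.mem_filter.mpr ⟨hP, i, hPi⟩, hne, hPi⟩)
        · rw [hend] at hPi
          exact hitCount_lt_of_not_subset hA (hZ P hP) hPi

/-- One level of the recursion: from `κ₁` outer cuts to `κ₀ + (κ₁ - 1) * κ₂` cuts. -/
lemma LeavesUnstabbed.refine {j u κ₀ κ₁ κ₂ c : ℕ} {f : ℕ → ℕ} (hj : 3 ≤ j) (hu : 0 < u)
    (hκ₁ : 0 < κ₁) (h₀ : LeavesSlack j 1 κ₀ (4 * j * u * c) u)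
    (h₂ : LeavesSlack j 2 κ₂ (4 * j * u * c) u)
    (h₁ : ∀ c, 0 < c → LeavesUnstabbed j κ₁ c (f c)) :
    LeavesUnstabbed j (κ₀ + (κ₁ - 1) * κ₂) c (blockLength f u (4 * j * u * c)) := by
  intro s Z hZ hcard
  refine (exists_unstabbed_blockLength hj hu hκ₁ h₀ h₂ h₁ _ le_rfl).2 s Z hZ ?_
  calc 4 * j * u * Z.card ≤ 4 * j * u * (c * blockLength f u (4 * j * u * c)) := by gcongr
    _ = 4 * j * u * c * blockLength f u (4 * j * u * c) := by ring

lemma ackH_succ_succ (k n : ℕ) : ackH (k + 1) (n + 1) = ackH k (ackH (k + 1) n) := by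
  rw [ackH]

lemma ackH_succ_zero (k : ℕ) : ackH (k + 1) 0 = 1 := by rw [ackH]

lemma two_mul_le_ackH (k n : ℕ) : 2 * n ≤ ackH k n := by
  induction k generalizing n with
  | zero => rw [ackH]
  | succ k ih =>
    have hlt : ∀ n, n < ackH (k + 1) n := by
      intro n
      induction n with
      | zero => rw [ackH_succ_zero]; omega
      | succ n ihn =>
        rw [ackH_succ_succ]
        have := ih (ackH (k + 1) n)
        omega
    cases n with
    | zero => simp
    | succ n =>
      rw [ackH_succ_succ]
      have := ih (ackH (k + 1) n)
      have := hlt n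
      omega

lemma le_ackH (k n : ℕ) : n ≤ ackH k n := by
  have := two_mul_le_ackH k n
  omega

lemma two_pow_le_ackH (k n : ℕ) : 2 ^ n ≤ ackH (k + 1) n := by
  induction n with
  | zero => rw [ackH_succ_zero, pow_zero]
  | succ n ih =>
    rw [ackH_succ_succ, pow_succ]
    have := two_mul_le_ackH k (ackH (k + 1) n)
    omega

lemma ackH_strictMono (k : ℕ) : StrictMono (ackH k) := by
  cases k with
  | zero =>
    intro a b h
    rw [ackH, ackH]
    omega
  | succ k =>
    refine strictMono_nat_of_lt_succ fun n => ?_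
    rw [ackH_succ_succ]
    have h1 := two_mul_le_ackH k (ackH (k + 1) n)
    have h2 := two_pow_le_ackH k n
    have h3 : 0 < 2 ^ n := by positivity
    omega

lemma ackH_le_succ (k n : ℕ) : ackH k n ≤ ackH (k + 1) n := by
  cases n with
  | zero =>
    rw [ackH_succ_zero]
    cases k with
    | zero => simp [ackH]
    | succ k => rw [ackH_succ_zero]
  | succ n =>
    rw [ackH_succ_succ]
    refine (ackH_strictMono k).monotone ?_
    have h1 := two_pow_le_ackH k n
    have h2 : n < 2 ^ n := Nat.lt_two_pow_self
    omega

lemma ackH_mono_left {k l : ℕ} (h : k ≤ l) (n : ℕ) : ackH k n ≤ ackH l n :=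
  monotone_nat_of_le_succ (f := fun k => ackH k n) (fun k => ackH_le_succ k n) h

lemma ackH_succ_add (k n p : ℕ) : ackH (k + 1) (n + p) = (ackH k)^[p] (ackH (k + 1) n) := by
  induction p with
  | zero => rfl
  | succ p ih => rw [← add_assoc, ackH_succ_succ, ih, Function.iterate_succ_apply']

lemma iterate_ackH_le {k a b x y : ℕ} (hab : a ≤ b) (hxy : x ≤ y) :
    (ackH k)^[a] x ≤ (ackH k)^[b] y := by
  obtain ⟨i, rfl⟩ := Nat.exists_eq_add_of_le hab
  rw [Function.iterate_add_apply]
  refine (ackH_strictMono k).monotone.iterate a (hxy.trans ?_)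
  exact Function.id_le_iterate_of_id_le (fun n => le_ackH k n) i y

lemma two_pow_mul_le_iterate_ackH (k i x : ℕ) : 2 ^ i * x ≤ (ackH k)^[i] x := by
  induction i with
  | zero => simp
  | succ i ih =>
    rw [Function.iterate_succ_apply', pow_succ]
    have := two_mul_le_ackH k ((ackH k)^[i] x)
    nlinarith

lemma two_mul_sq_le_ackH_ackH (k : ℕ) {x : ℕ} : 2 * x ^ 2 ≤ ackH (k + 1) (ackH (k + 1) x) := by
  have h1 : 2 * x ≤ 2 ^ x := by
    cases x with
    | zero => simp
    | succ n =>
      have : n < 2 ^ n := Nat.lt_two_pow_self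
      rw [pow_succ]
      omega
  calc 2 * x ^ 2 ≤ (2 * x) ^ 2 := by nlinarith
    _ ≤ (2 ^ x) ^ 2 := Nat.pow_le_pow_left h1 2
    _ = 2 ^ (2 * x) := by rw [← pow_mul, Nat.mul_comm]
    _ ≤ ackH (k + 1) (2 * x) := two_pow_le_ackH k _
    _ ≤ _ := (ackH_strictMono _).monotone (two_mul_le_ackH _ x)

lemma blockLength_le {f : ℕ → ℕ} {k e u : ℕ} (hu : 0 < u) (hf₀ : ∀ c, 0 < c → 0 < f c)
    (hf : ∀ c, 0 < c → f c ≤ (ackH (k + 1))^[e] c) (L : ℕ) :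
    0 < blockLength f u L ∧ blockLength f u L ≤ ackH (k + 2) (u + (e + 2) * (L + 1)) := by
  have step : ∀ T, 0 < T →
      0 < 2 * T * f T ∧ 2 * T * f T ≤ (ackH (k + 1))^[e + 2] T := by
    intro T hT
    refine ⟨Nat.mul_pos (by omega) (hf₀ T hT), ?_⟩
    set y := (ackH (k + 1))^[e] T with hy
    have hTy : T ≤ y := iterate_ackH_le (a := 0) (Nat.zero_le e) le_rfl
    calc 2 * T * f T ≤ 2 * y * y := by
          gcongr
          exact hf T hT
      _ = 2 * y ^ 2 := by ring
      _ ≤ ackH (k + 1) (ackH (k + 1) y) := two_mul_sq_le_ackH_ackH k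
      _ = (ackH (k + 1))^[e + 2] T := by
          rw [Function.iterate_succ_apply', Function.iterate_succ_apply']
  have key : 0 < blockLength f u L ∧
      blockLength f u L ≤ (ackH (k + 1))^[(e + 2) * (L + 1)] u := by
    induction L with
    | zero => simpa [blockLength_zero] using step u hu
    | succ L ih =>
      rw [blockLength_succ]
      refine ⟨(step _ ih.1).1, (step _ ih.1).2.trans ?_⟩
      rw [show (e + 2) * (L + 1 + 1) = (e + 2) + (e + 2) * (L + 1) by ring,
        Function.iterate_add_apply _ (e + 2) ((e + 2) * (L + 1))]
      exact iterate_ackH_le le_rfl ih.2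
  refine ⟨key.1, key.2.trans ?_⟩
  rw [ackH_succ_add]
  exact iterate_ackH_le le_rfl (le_ackH _ u)

/-- `q m` cuts survive in windows of length bounded by a fixed iterate of the `m`-th level of the
Ackermann hierarchy. -/
def AckermannUnstabbed (j : ℕ) (q : ℕ → ℕ) : Prop :=
  ∃ e, ∀ m c, 0 < c → ∃ n ≤ (ackH (m + 1))^[e] c, LeavesUnstabbed j (q m) c n

lemma leavesUnstabbed_two {j : ℕ} (hj : 2 ≤ j) (c : ℕ) : LeavesUnstabbed j 2 c 2 := by
  intro s Z _ _
  refine ⟨Finset.Ico s (s + 2), subset_rfl, by simp, fun P _ => ?_⟩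
  have := hitCount_lt_card (Finset.Ico s (s + 2)) P (by simp)
  simp only [Nat.card_Ico] at this
  omega

lemma two_le_iterate_ackH {k e c : ℕ} (he : 0 < e) (hc : 0 < c) : 2 ≤ (ackH k)^[e] c :=
  calc 2 ≤ 2 ^ 1 * 1 := by norm_num
    _ ≤ (ackH k)^[1] 1 := two_pow_mul_le_iterate_ackH k 1 1
    _ ≤ _ := iterate_ackH_le he hc

lemma AckermannUnstabbed.of_leavesSlack {j e₀ : ℕ} {κ₀ κ₂ q : ℕ → ℕ} (hj : 3 ≤ j)
    (hslack : ∀ m c, 0 < c → ∃ u, 0 < u ∧ u ≤ (ackH (m + 1))^[e₀] c ∧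
      LeavesSlack j 1 (κ₀ m) (4 * j * u * c) u ∧ LeavesSlack j 2 (κ₂ m) (4 * j * u * c) u)
    (hq₀ : q 0 = 2) (hq : ∀ m, q (m + 1) = κ₀ (m + 1) + (q m - 1) * κ₂ (m + 1))
    (hqpos : ∀ m, 0 < q m) : AckermannUnstabbed j q := by
  set h := e₀ + 4 * j + 5 with hh
  refine ⟨e₀ + (h + 3), fun m => ?_⟩
  induction m with
  | zero =>
    intro c hc
    refine ⟨2, two_le_iterate_ackH (by omega) hc, ?_⟩
    rw [hq₀]
    exact leavesUnstabbed_two (by omega) c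
  | succ m ih =>
    intro c hc
    choose! f hfle hf using ih
    obtain ⟨u, hu, hule, hs₀, hs₂⟩ := hslack (m + 1) c hc
    refine ⟨blockLength f u (4 * j * u * c), ?_, ?_⟩
    · refine (blockLength_le hu (fun c hc => (hqpos m).trans_le (hf c hc).le) hfle _).2.trans ?_
      set U := (ackH (m + 1 + 1))^[e₀] c with hU
      have hcU : c ≤ U := iterate_ackH_le (a := 0) (Nat.zero_le _) le_rfl
      have h2 : (ackH (m + 1 + 1))^[e₀ + (h + 3)] c =
          ackH (m + 1 + 1) ((ackH (m + 1 + 1))^[h + 2] U) := by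
        rw [add_comm e₀, Function.iterate_add_apply, ← hU, Function.iterate_succ_apply']
      rw [h2]
      refine (ackH_strictMono _).monotone ?_
      rw [Function.iterate_succ_apply', Function.iterate_succ_apply']
      refine le_trans ?_ (two_mul_sq_le_ackH_ackH _)
      have h3 := two_pow_mul_le_iterate_ackH (m + 1 + 1) h U
      have hX : e₀ + 4 * j + 6 ≤ 2 ^ h := by
        have : h < 2 ^ h := Nat.lt_two_pow_self
        omega
      have hU1 : 1 ≤ U := hc.trans_le hcU
      calc u + (e₀ + (h + 3) + 2) * (4 * j * u * c + 1)
          ≤ U * U + (e₀ + (h + 3) + 2) * (4 * j * (U * U) + U * U) := by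
            have huc : u * c ≤ U * U := Nat.mul_le_mul hule hcU
            have hUU : U ≤ U * U := Nat.le_mul_self U
            rw [mul_assoc (4 * j)]
            gcongr
            · exact hule.trans hUU
            · exact hU1.trans hUU
        _ = (1 + (e₀ + (h + 3) + 2) * (4 * j + 1)) * (U * U) := by ring
        _ ≤ (2 * (e₀ + 4 * j + 6) ^ 2) * (U * U) := by
            gcongr
            rw [hh]
            nlinarith
        _ ≤ (2 * (2 ^ h) ^ 2) * (U * U) := by gcongr
        _ = 2 * (2 ^ h * U) ^ 2 := by ring
        _ ≤ _ := by gcongr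
    · rw [hq]
      exact LeavesUnstabbed.refine hj hu (hqpos m) hs₀ hs₂ hf

lemma LeavesUnstabbed.leavesSlack {i κ c u : ℕ}
    (h : LeavesUnstabbed i κ (2 ^ (i + 2) * (4 * (i + 2)) * c) u) :
    LeavesSlack (i + 2) 2 κ (4 * (i + 2) * u * c) u := by
  classical
  intro s Z hZ hcard
  obtain ⟨A, hA, hAc, hAZ⟩ := h s (Z.biUnion fun P => P.powersetCard i)
    (by
      intro Q hQ
      obtain ⟨P, _, hQ⟩ := Finset.mem_biUnion.mp hQ
      exact (Finset.mem_powersetCard.mp hQ).2.le)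
    (by
      calc (Z.biUnion fun P => P.powersetCard i).card ≤ Z.card * 2 ^ (i + 2) := by
            refine Finset.card_biUnion_le_card_mul _ _ _ fun P hP => ?_
            rw [Finset.card_powersetCard]
            exact (Nat.choose_le_two_pow _ _).trans (Nat.pow_le_pow_right (by omega) (hZ P hP))
        _ ≤ (4 * (i + 2) * u * c) * 2 ^ (i + 2) := by gcongr
        _ = _ := by ring)
  refine ⟨A, hA, hAc, fun P hP => ?_⟩
  by_contra! hlt
  obtain ⟨Q, hQP, hQc, hQ⟩ := exists_subset_le_hitCount (show i ≤ hitCount A P by omega)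
  have := hAZ Q (Finset.mem_biUnion.mpr ⟨P, hP, Finset.mem_powersetCard.mpr ⟨hQP, hQc⟩⟩)
  omega

lemma LeavesSlack.weaken {j κ L u : ℕ} (h : LeavesSlack j 2 κ L u) : LeavesSlack j 1 κ L u := by
  intro s Z hZ hc
  obtain ⟨A, hA, hAc, hAZ⟩ := h s Z hZ hc
  exact ⟨A, hA, hAc, fun P hP => by have := hAZ P hP; omega⟩

lemma AckermannUnstabbed.add_two {i : ℕ} {p q : ℕ → ℕ} (hi : 2 ≤ i)
    (h : AckermannUnstabbed i p) (hp : ∀ m, 0 < p m) (hq₀ : q 0 = 2)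
    (hq : ∀ m, q (m + 1) = q m * p (m + 1)) : AckermannUnstabbed (i + 2) q := by
  have hqpos : ∀ m, 0 < q m := by
    intro m
    induction m with
    | zero => omega
    | succ m ih => rw [hq]; exact Nat.mul_pos ih (hp _)
  obtain ⟨e, he⟩ := h
  set K := 2 ^ (i + 2) * (4 * (i + 2)) with hK
  have hKpos : 0 < K := by positivity
  refine AckermannUnstabbed.of_leavesSlack (e₀ := e + K) (κ₀ := p) (κ₂ := p) (by omega)
    (fun m c hc => ?_) hq₀ (fun m => ?_) hqpos
  · obtain ⟨u, hu, hun⟩ := he m (K * c) (Nat.mul_pos hKpos hc)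
    refine ⟨u, (hp m).trans_le hun.le, hu.trans ?_, hun.leavesSlack.weaken, hun.leavesSlack⟩
    rw [Function.iterate_add_apply]
    refine iterate_ackH_le le_rfl (le_trans ?_ (two_pow_mul_le_iterate_ackH _ K c))
    gcongr
    exact Nat.lt_two_pow_self.le
  · rw [hq]
    obtain ⟨k, hk⟩ : ∃ k, q m = k + 1 := ⟨q m - 1, by have := hqpos m; omega⟩
    rw [hk]
    simp only [Nat.add_sub_cancel]
    ring

lemma ackermannUnstabbed_two : AckermannUnstabbed 2 fun _ => 2 :=
  ⟨1, fun _ c hc => ⟨2, two_le_iterate_ackH one_pos hc, leavesUnstabbed_two le_rfl c⟩⟩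

lemma ackermannUnstabbed_three : AckermannUnstabbed 3 fun m => m + 2 := by
  refine AckermannUnstabbed.of_leavesSlack (e₀ := 1) (κ₀ := fun _ => 2) (κ₂ := fun _ => 1) le_rfl
    (fun m c hc => ⟨2, two_pos, two_le_iterate_ackH one_pos hc, ?_, ?_⟩) rfl (fun m => by omega)
    (fun m => by omega)
  · intro s Z _ _
    refine ⟨Finset.Ico s (s + 2), subset_rfl, by simp, fun P _ => ?_⟩
    have := hitCount_lt_card (Finset.Ico s (s + 2)) P (by simp)
    simp only [Nat.card_Ico] at this
    omega
  · intro s Z _ _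
    refine ⟨{s}, by simp, by simp, fun P _ => ?_⟩
    have := hitCount_lt_card {s} P (by simp)
    simp only [Finset.card_singleton] at this
    omega

/-- The number of cuts obtained after `t` dimension-raising steps from `b`. -/
def cutCount (b : ℕ → ℕ) : ℕ → ℕ → ℕ
  | 0, m => b m
  | _ + 1, 0 => 2
  | t + 1, m + 1 => cutCount b (t + 1) m * cutCount b t (m + 1)

lemma cutCount_pos {b : ℕ → ℕ} (hb : ∀ m, 0 < b m) (t m : ℕ) : 0 < cutCount b t m := by
  fun_induction cutCount b t m with
  | case1 m => exact hb m
  | case2 => omega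
  | case3 t m ih₁ ih₂ => exact Nat.mul_pos ih₁ ih₂

lemma cutCount_zero (b : ℕ → ℕ) (m : ℕ) : cutCount b 0 m = b m := by rw [cutCount]

lemma cutCount_succ_zero (b : ℕ → ℕ) (t : ℕ) : cutCount b (t + 1) 0 = 2 := by rw [cutCount]

lemma cutCount_succ_succ (b : ℕ → ℕ) (t m : ℕ) :
    cutCount b (t + 1) (m + 1) = cutCount b (t + 1) m * cutCount b t (m + 1) := by rw [cutCount]

lemma AckermannUnstabbed.raise {j : ℕ} {b : ℕ → ℕ} (hj : 2 ≤ j) (hb : ∀ m, 0 < b m)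
    (h : AckermannUnstabbed j b) (t : ℕ) : AckermannUnstabbed (j + 2 * t) (cutCount b t) := by
  induction t with
  | zero =>
    have : cutCount b 0 = b := funext (cutCount_zero b)
    rwa [this]
  | succ t ih =>
    rw [show j + 2 * (t + 1) = j + 2 * t + 2 by ring]
    exact AckermannUnstabbed.add_two (by omega) ih (cutCount_pos hb t) (cutCount_succ_zero b t)
      (cutCount_succ_succ b t)

lemma cutCount_two (t m : ℕ) : cutCount (fun _ => 2) t m = 2 ^ (m + t).choose t := by
  fun_induction cutCount (fun _ => 2) t m with
  | case1 m => simp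
  | case2 => simp
  | case3 t m ih₁ ih₂ =>
    rw [ih₁, ih₂, ← pow_add, show m + 1 + (t + 1) = (m + t + 1) + 1 by ring,
      Nat.choose_succ_succ', show m + (t + 1) = m + t + 1 by ring,
      show m + 1 + t = m + t + 1 by ring, add_comm]

/-- The rapidly growing bases of the curve on which `n` points are placed. -/
def curveBase (n : ℕ) : ℕ → ℕ
  | 0 => 5
  | i + 1 => 5 * n * curveBase n i ^ n

lemma curveBase_lt_succ {n : ℕ} (hn : 0 < n) (i : ℕ) :
    5 ≤ curveBase n i ∧ curveBase n i < curveBase n (i + 1) := by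
  have hstep : ∀ i, 5 ≤ curveBase n i → curveBase n i < curveBase n (i + 1) := by
    intro i hi
    rw [curveBase]
    calc curveBase n i ≤ curveBase n i ^ n := Nat.le_self_pow hn.ne' _
      _ < 5 * n * curveBase n i ^ n := by
        have : 0 < curveBase n i ^ n := by positivity
        nlinarith
  induction i with
  | zero => exact ⟨by rw [curveBase], hstep 0 (by rw [curveBase])⟩
  | succ i ih =>
    have : 5 ≤ curveBase n (i + 1) := ih.1.trans ih.2.le
    exact ⟨this, hstep _ this⟩

lemma curveBase_strictMono {n : ℕ} (hn : 0 < n) : StrictMono (curveBase n) :=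
  strictMono_nat_of_lt_succ fun i => (curveBase_lt_succ hn i).2

lemma mul_pow_le_curveBase {n i k : ℕ} (hn : 0 < n) (hik : i < k) :
    5 * n * curveBase n i ^ n ≤ curveBase n k := by
  have := (curveBase_strictMono hn).monotone (show i + 1 ≤ k from hik)
  rwa [curveBase] at this

/-- The `a`-th point on the curve. -/
def curvePoint (d n a : ℕ) : Fin d → ℝ := fun i => (curveBase n i : ℝ) ^ a

/-- The scales of the coordinates of `x` with respect to the bases of the curve. -/
noncomputable def curveLevels {d : ℕ} (n : ℕ) (x : Fin d → ℝ) : Finset ℕ :=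
  Finset.univ.image fun i : Fin d => Nat.log (curveBase n i) ⌊x i⌋₊

/-- Some coordinate of `x` is comparable with that of the `a`-th point. -/
def IsNear {d : ℕ} (n : ℕ) (x : Fin d → ℝ) (a : ℕ) : Prop :=
  ∃ i : Fin d, 5 * (curveBase n i : ℝ) ^ a ≤ 2 * curveBase n i * x i ∧
    x i ≤ 2 * (curveBase n i : ℝ) ^ a

/-- The convex combinations of the points indexed by `A`. -/
def curveHull (d n : ℕ) (A : Finset ℕ) : Set (Fin d → ℝ) :=
  {x | ∃ l : ℕ → ℝ, (∀ a ∈ A, 0 ≤ l a) ∧ ∑ a ∈ A, l a = 1 ∧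
    ∀ i, x i = ∑ a ∈ A, l a * curvePoint d n a i}

lemma convex_curveHull (d n : ℕ) (A : Finset ℕ) : Convex ℝ (curveHull d n A) := by
  rintro x ⟨l, hl₀, hl₁, hlx⟩ y ⟨m, hm₀, hm₁, hmy⟩ a b ha hb hab
  refine ⟨fun k => a * l k + b * m k, fun k hk => ?_, ?_, fun i => ?_⟩
  · have := hl₀ k hk
    have := hm₀ k hk
    positivity
  · rw [Finset.sum_add_distrib, ← Finset.mul_sum, ← Finset.mul_sum, hl₁, hm₁]
    linarith
  · simp only [Pi.add_apply, Pi.smul_apply, smul_eq_mul, hlx, hmy, add_mul, mul_assoc,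
      Finset.sum_add_distrib, ← Finset.mul_sum]

lemma curvePoint_mem_curveHull {d n a : ℕ} {A : Finset ℕ} (ha : a ∈ A) :
    curvePoint d n a ∈ curveHull d n A := by
  refine ⟨fun b => if b = a then 1 else 0, fun b _ => by positivity, ?_, fun i => ?_⟩
  · simp [ha]
  · simp [ha]

lemma card_isNear_le {d n : ℕ} (hn : 0 < n) (x : Fin d → ℝ) (S : Finset ℕ)
    (hS : ∀ a ∈ S, IsNear n x a) : S.card ≤ d := by
  rcases S.eq_empty_or_nonempty with rfl | ⟨a₀, ha₀⟩
  · simp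
  have : Nonempty (Fin d) := ⟨(hS a₀ ha₀).choose⟩
  choose! i hi using hS
  have hinj : ∀ a ∈ S, ∀ b ∈ S, a < b → i a ≠ i b := by
    intro a ha b hb hab heq
    have h1 := (hi a ha).2
    have h2 := (hi b hb).1
    rw [← heq] at h2
    have hc : (5 : ℝ) ≤ curveBase n (i a) := by exact_mod_cast (curveBase_lt_succ hn (i a)).1
    set c : ℝ := (curveBase n (i a) : ℝ)
    have h3 : c ^ (a + 1) ≤ c ^ b := pow_le_pow_right₀ (by linarith) hab
    have h4 : 0 < c ^ b := by positivity
    rw [pow_succ] at h3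
    nlinarith
  have := Finset.card_le_card_of_injOn (s := S) (t := Finset.univ) i (fun _ _ => by simp)
    (fun a ha b hb heq => by
      by_contra hne
      rcases lt_or_gt_of_ne hne with h | h
      · exact hinj a ha b hb h heq
      · exact hinj b hb a ha h heq.symm)
  simpa using this

/-- A convex combination of well-separated points has a scale in each of `d` gaps. -/
lemma le_hitCount_curveLevels {d n : ℕ} {A : Finset ℕ} {x : Fin d → ℝ}
    (hA : ∀ a ∈ A, a < n) (hx : x ∈ curveHull d n A) (hnear : ∀ a ∈ A, ¬ IsNear n x a) :
    d ≤ hitCount A (curveLevels n x) := by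
  classical
  obtain ⟨l, hl₀, hl₁, hlx⟩ := hx
  have hAne : A.Nonempty := by
    rw [Finset.nonempty_iff_ne_empty]
    rintro rfl
    simp at hl₁
  have hn : 0 < n := by
    obtain ⟨a, ha⟩ := hAne
    exact (Nat.zero_le a).trans_lt (hA a ha)
  have hc5 : ∀ i : ℕ, (5 : ℝ) ≤ curveBase n i := fun i => by
    exact_mod_cast (curveBase_lt_succ hn i).1
  have hlow : ∀ (i : Fin d) (y : ℝ), (∀ a ∈ A, y ≤ (curveBase n i : ℝ) ^ a) → y ≤ x i := by
    intro i y hy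
    calc y = ∑ a ∈ A, l a * y := by rw [← Finset.sum_mul, hl₁, one_mul]
      _ ≤ ∑ a ∈ A, l a * curvePoint d n a i :=
        Finset.sum_le_sum fun a ha => mul_le_mul_of_nonneg_left (hy a ha) (hl₀ a ha)
      _ = x i := (hlx i).symm
  have hup : ∀ (i : Fin d) (y : ℝ), (∀ a ∈ A, (curveBase n i : ℝ) ^ a ≤ y) → x i ≤ y := by
    intro i y hy
    calc x i = ∑ a ∈ A, l a * curvePoint d n a i := hlx i
      _ ≤ ∑ a ∈ A, l a * y :=
        Finset.sum_le_sum fun a ha => mul_le_mul_of_nonneg_left (hy a ha) (hl₀ a ha)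
      _ = y := by rw [← Finset.sum_mul, hl₁, one_mul]
  have hx1 : ∀ i, 1 ≤ x i := fun i =>
    hlow i 1 fun a _ => one_le_pow₀ (by linarith [hc5 i])
  set s : Fin d → ℕ := fun i => Nat.log (curveBase n i) ⌊x i⌋₊ with hs
  have hfl : ∀ i, ⌊x i⌋₊ ≠ 0 := fun i => (Nat.floor_pos.mpr (hx1 i)).ne'
  have hslow : ∀ i : Fin d, (curveBase n i : ℝ) ^ s i ≤ x i := by
    intro i
    have := (Nat.le_floor_iff (by linarith [hx1 i])).mp
      (Nat.pow_log_le_self (curveBase n i) (hfl i))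
    exact_mod_cast this
  have hsup : ∀ i : Fin d, x i < (curveBase n i : ℝ) ^ (s i + 1) := by
    intro i
    have := (Nat.floor_lt (by linarith [hx1 i])).mp
      (Nat.lt_pow_succ_log_self (show 1 < curveBase n i by
        have := (curveBase_lt_succ hn i).1; omega) ⌊x i⌋₊)
    exact_mod_cast this
  -- the point is far from each coordinate power occurring in `A`
  have hfar : ∀ i : Fin d, ∀ a ∈ A, 5 * (curveBase n i : ℝ) ^ a ≤ 2 * curveBase n i * x i →
      2 * (curveBase n i : ℝ) ^ a < x i := by
    intro i a ha h
    by_contra! hle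
    exact hnear a ha ⟨i, h, hle⟩
  have hpos : ∀ i, 0 < cutRank A (s i) := by
    intro i
    by_contra! h0
    have hgt : ∀ a ∈ A, s i + 1 ≤ a := by
      intro a ha
      by_contra! hle
      have : 0 < cutRank A (s i) :=
        Finset.card_pos.mpr ⟨a, Finset.mem_filter.mpr ⟨ha, by omega⟩⟩
      omega
    have := hlow i ((curveBase n i : ℝ) ^ (s i + 1)) fun a ha =>
      pow_le_pow_right₀ (by linarith [hc5 i]) (hgt a ha)
    linarith [hsup i]
  have hlt : ∀ i, cutRank A (s i) < A.card := by
    intro i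
    refine lt_of_le_of_ne (cutRank_le_card _ _) fun heq => ?_
    have hle : ∀ a ∈ A, a ≤ s i := by
      have : A.filter (· ≤ s i) = A := Finset.eq_of_subset_of_card_le (Finset.filter_subset _ _)
        heq.ge
      exact Finset.filter_eq_self.mp this
    set b := A.max' hAne with hb
    have hbA : b ∈ A := Finset.max'_mem _ _
    have hxb := hup i ((curveBase n i : ℝ) ^ b) fun a ha =>
      pow_le_pow_right₀ (by linarith [hc5 i]) (Finset.le_max' A a ha)
    have hbx : (curveBase n i : ℝ) ^ b ≤ x i :=
      (pow_le_pow_right₀ (by linarith [hc5 i]) (hle b hbA)).trans (hslow i)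
    have := hfar i b hbA (by nlinarith [hc5 i, hx1 i])
    linarith [hx1 i]
  have hsep : ∀ i k : Fin d, i < k → cutRank A (s i) < cutRank A (s k) := by
    intro i k hik
    by_contra! hle
    have hgap : ∀ a ∈ A, s i < a → s k < a := by
      intro a ha hia
      by_contra! hka
      exact absurd (cutRank_lt_cutRank ha hia hka) (not_lt.mpr hle)
    have hnR : (0 : ℝ) < n := by exact_mod_cast hn
    set c : ℝ := (curveBase n i : ℝ) with hc
    have hc5i : 5 ≤ c := hc5 i
    have hck : 5 * n * c ^ n ≤ (curveBase n k : ℝ) := by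
      rw [hc]
      exact_mod_cast mul_pow_le_curveBase hn hik
    have hcn : 0 < c ^ n := by positivity
    have hhigh : ∀ a ∈ A, s i < a → l a * c ^ a ≤ 1 / (2 * n) := by
      intro a ha hia
      have hka := hgap a ha hia
      set e : ℝ := (curveBase n k : ℝ) with he
      have he5 : 5 ≤ e := hc5 k
      have hxa : x k < e ^ a :=
        (hsup k).trans_le (pow_le_pow_right₀ (by linarith) hka)
      have hea : 0 < e ^ a := by positivity
      have h1 : 2 * e * x k < 5 * e ^ a := by
        by_contra! hcon
        have := hfar k a ha hcon
        linarith
      have h2 : l a * e ^ a ≤ x k := by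
        rw [hlx k]
        exact Finset.single_le_sum (f := fun b => l b * curvePoint d n b k)
          (fun b hb => mul_nonneg (hl₀ b hb) (by unfold curvePoint; positivity)) ha
      have h3 : l a * (2 * e) ≤ 5 := by
        have : l a * (2 * e) * e ^ a ≤ 5 * e ^ a := by nlinarith
        exact le_of_mul_le_mul_right this hea
      have h4 : c ^ a ≤ c ^ n := pow_le_pow_right₀ (by linarith) (hA a ha).le
      rw [le_div_iff₀ (by positivity)]
      have h5 := hl₀ a ha
      have h6 : l a * (5 * n * c ^ n) ≤ l a * e := mul_le_mul_of_nonneg_left hck h5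
      have h7 : l a * c ^ a ≤ l a * c ^ n := mul_le_mul_of_nonneg_left h4 h5
      have h8 : l a * c ^ a * n ≤ l a * c ^ n * n := mul_le_mul_of_nonneg_right h7 hnR.le
      nlinarith
    have hbound : ∀ y : ℝ, 0 ≤ y → (∀ a ∈ A, a ≤ s i → c ^ a ≤ y) → x i ≤ y + 1 / 2 := by
      intro y hy hya
      have hterm : ∀ a ∈ A, l a * curvePoint d n a i ≤ l a * y + 1 / (2 * n) := by
        intro a ha
        have h5 := hl₀ a ha
        by_cases h : a ≤ s i
        · have := mul_le_mul_of_nonneg_left (hya a ha h) h5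
          have : (0 : ℝ) ≤ 1 / (2 * n) := by positivity
          simp only [curvePoint]
          linarith
        · have := hhigh a ha (by omega)
          have := mul_nonneg h5 hy
          simp only [curvePoint]
          linarith
      have hcard : (A.card : ℝ) ≤ n := by
        have : A ⊆ Finset.range n := fun a ha => Finset.mem_range.mpr (hA a ha)
        exact_mod_cast (Finset.card_le_card this).trans_eq (Finset.card_range n)
      calc x i = ∑ a ∈ A, l a * curvePoint d n a i := hlx i
        _ ≤ ∑ a ∈ A, (l a * y + 1 / (2 * n)) := Finset.sum_le_sum hterm
        _ = y + A.card * (1 / (2 * n)) := by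
          rw [Finset.sum_add_distrib, ← Finset.sum_mul, hl₁, one_mul, Finset.sum_const,
            nsmul_eq_mul]
        _ ≤ y + n * (1 / (2 * n)) := by gcongr
        _ = y + 1 / 2 := by field_simp
    have hcs : 1 ≤ c ^ s i := one_le_pow₀ (by linarith)
    by_cases hsA : s i ∈ A
    · have h1 := hfar i (s i) hsA (by nlinarith [hslow i, hx1 i])
      have h2 := hbound (c ^ s i) (by positivity) fun a _ h =>
        pow_le_pow_right₀ (by linarith) h
      linarith
    · have h2 := hbound (c ^ s i / 5) (by positivity) fun a ha h => by
        have hne : a ≠ s i := fun h => hsA (h ▸ ha)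
        have h3 : c ^ (a + 1) ≤ c ^ s i := pow_le_pow_right₀ (by linarith) (by omega)
        have h4 : 0 < c ^ a := by positivity
        rw [pow_succ] at h3
        rw [le_div_iff₀ (by norm_num)]
        nlinarith
      linarith [hslow i]
  have hmono : StrictMono fun i => cutRank A (s i) := fun i k h => hsep i k h
  calc d = (Finset.univ.image fun i => cutRank A (s i)).card := by
        rw [Finset.card_image_of_injective _ hmono.injective, Finset.card_univ, Fintype.card_fin]
    _ ≤ hitCount A (curveLevels n x) := by
        refine Finset.card_le_card fun v hv => ?_
        obtain ⟨i, _, rfl⟩ := Finset.mem_image.mp hv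
        refine Finset.mem_inter.mpr ⟨Finset.mem_image.mpr ⟨s i, ?_, rfl⟩,
          Finset.mem_Ioo.mpr ⟨hpos i, hlt i⟩⟩
        exact Finset.mem_image.mpr ⟨i, Finset.mem_univ i, rfl⟩

lemma curvePoint_injective {d n : ℕ} (hd : 0 < d) (hn : 0 < n) :
    Function.Injective (curvePoint d n) := by
  intro a b h
  have h0 := congrFun h ⟨0, hd⟩
  simp only [curvePoint] at h0
  have := (curveBase_lt_succ hn 0).1
  exact Nat.pow_right_injective (show 2 ≤ curveBase n 0 by omega) (by exact_mod_cast h0)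

lemma lt_mul_card_of_isWeakNet {d κ F q : ℕ} (hd : 0 < d) (hF : 0 < F) (hq : 0 < q)
    (h : LeavesUnstabbed d κ 1 F) {r : ℝ} (hr : 0 < r) (hnr : (2 * (q * F) : ℕ) ≤ κ * r)
    {N : Finset (Fin d → ℝ)}
    (hN : IsWeakNet ((Finset.range (2 * (q * F))).image (curvePoint d (2 * (q * F)))) (1 / r)
      (↑N : Set (Fin d → ℝ))) : q * F < d * N.card := by
  classical
  by_contra! hcard
  set n := 2 * (q * F) with hn
  have hqF : 0 < q * F := Nat.mul_pos hq hF
  have hnpos : 0 < n := by omega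
  set S := (Finset.range n).filter fun a => ∀ x ∈ N, ¬ IsNear n x a with hS
  have hScard : q * F ≤ S.card := by
    set B := (Finset.range n).filter fun a => ¬ ∀ x ∈ N, ¬ IsNear n x a with hB
    have hsum : S.card + B.card = n := by
      rw [hS, hB, Finset.card_filter_add_card_filter_not, Finset.card_range]
    have hBsub : B ⊆ N.biUnion fun x => (Finset.range n).filter fun a => IsNear n x a := by
      intro a ha
      obtain ⟨han, ha⟩ := Finset.mem_filter.mp ha
      push Not at ha
      obtain ⟨x, hx, hxa⟩ := ha
      exact Finset.mem_biUnion.mpr ⟨x, hx, Finset.mem_filter.mpr ⟨han, hxa⟩⟩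
    have hBc : B.card ≤ N.card * d :=
      (Finset.card_le_card hBsub).trans (Finset.card_biUnion_le_card_mul _ _ _ fun x _ =>
        card_isNear_le hnpos x _ fun a ha => (Finset.mem_filter.mp ha).2)
    rw [Nat.mul_comm] at hBc
    omega
  set e := S.orderEmbOfCardLe hScard
  set st : ℕ → ℕ := fun y => if hy : y - 1 < q * F then e ⟨y - 1, hy⟩ else 0 with hst
  have hstS : ∀ y ∈ Set.Icc 1 (q * F), st y ∈ S := by
    rintro y ⟨h1, h2⟩
    have hy : y - 1 < q * F := by omega
    simp only [hst, hy, dif_pos]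
    exact Finset.orderEmbOfCardLe_mem S hScard _
  have hmono : StrictMonoOn st (Set.Icc 1 (q * F)) := by
    rintro y ⟨h1, h2⟩ y' ⟨h1', h2'⟩ hlt
    have hy : y - 1 < q * F := by omega
    have hy' : y' - 1 < q * F := by omega
    simp only [hst, hy, hy', dif_pos]
    exact e.strictMono (by rw [Fin.mk_lt_mk]; omega)
  set φ : ℕ → ℕ := fun x => ((Finset.Icc 1 (q * F)).filter fun i => st i ≤ x).card with hφ
  have hlev : ∀ x : Fin d → ℝ, (curveLevels n x).card ≤ d := fun x =>
    Finset.card_image_le.trans (by simp)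
  obtain ⟨a, ha, hac, haZ⟩ := h.mul hd q hq 1 (N.image fun x => (curveLevels n x).image φ)
    (by
      intro P hP
      obtain ⟨x, _, rfl⟩ := Finset.mem_image.mp hP
      exact Finset.card_image_le.trans (hlev x))
    (by
      refine Finset.card_image_le.trans ?_
      have : N.card ≤ d * N.card := Nat.le_mul_of_pos_left _ hd
      omega)
  have haI : ∀ y ∈ a, y ∈ Set.Icc 1 (q * F) := by
    intro y hy
    have := Finset.mem_Ico.mp (ha hy)
    exact ⟨this.1, by omega⟩
  have hstinj : Set.InjOn st a := fun y hy y' hy' heq =>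
    hmono.injOn (haI y hy) (haI y' hy') heq
  set A := a.biUnion fun y => {st y} with hA
  have hAS : A ⊆ S := by
    intro b hb
    obtain ⟨y, hy, hb⟩ := Finset.mem_biUnion.mp hb
    rw [Finset.mem_singleton] at hb
    exact hb ▸ hstS y (haI y hy)
  have hdisj : (a : Set ℕ).PairwiseDisjoint fun y => ({st y} : Finset ℕ) := by
    intro y hy y' hy' hne
    rw [Function.onFun, Finset.disjoint_singleton]
    exact fun heq => hne (hstinj hy hy' heq)
  have hAcard : A.card = κ := by
    rw [hA, Finset.card_biUnion fun y hy y' hy' hne => hdisj hy hy' hne]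
    simp [hac]
  obtain ⟨x, hxN, hxC⟩ := hN (curveHull d n A) (convex_curveHull d n A) (by
    have hsub : A.image (curvePoint d n) ⊆
        ((Finset.range n).image (curvePoint d n)).filter fun p => p ∈ curveHull d n A := by
      intro p hp
      obtain ⟨b, hb, rfl⟩ := Finset.mem_image.mp hp
      exact Finset.mem_filter.mpr ⟨Finset.mem_image_of_mem _ (Finset.mem_filter.mp (hAS hb)).1,
        curvePoint_mem_curveHull hb⟩
    have hκ := Finset.card_le_card hsub
    rw [Finset.card_image_of_injective _ (curvePoint_injective hd hnpos), hAcard] at hκ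
    have hX : (((Finset.range n).image (curvePoint d n)).card : ℝ) ≤ n := by
      exact_mod_cast Finset.card_image_le.trans_eq (Finset.card_range n)
    calc 1 / r * (((Finset.range n).image (curvePoint d n)).card : ℝ) ≤ 1 / r * (κ * r) := by
          gcongr
          exact hX.trans hnr
      _ = κ := by field_simp
      _ ≤ _ := by
        convert (Nat.cast_le (α := ℝ)).mpr hκ)
  have hhit := le_hitCount_curveLevels (fun b hb => Finset.mem_range.mp
    (Finset.mem_filter.mp (hAS hb)).1) hxC fun b hb => (Finset.mem_filter.mp (hAS hb)).2 x hxN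
  have hle : hitCount A (curveLevels n x) ≤ hitCount a ((curveLevels n x).image φ) := by
    refine hitCount_biUnion_le hdisj fun z _ y hy => ?_
    have hiff := le_card_filter_iff hmono (haI y hy) z
    by_cases hz : st y ≤ z
    · rw [if_pos (hiff.mp hz)]
      exact cutRank_eq_card (by simpa using hz)
    · rw [if_neg fun hcon => hz (hiff.mpr hcon)]
      exact cutRank_eq_zero (by simpa using hz)
  have := haZ _ (Finset.mem_image_of_mem _ hxN)
  omega

lemma ackH_one (k : ℕ) : ackH k 1 = 2 := by
  induction k with
  | zero => rw [ackH]
  | succ k ih => rw [ackH_succ_succ, ackH_succ_zero, ih]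

lemma ackH_two (k : ℕ) : ackH k 2 = 4 := by
  induction k with
  | zero => rw [ackH]
  | succ k ih => rw [ackH_succ_succ, ackH_one, ih]

lemma ackH_succ_three (k : ℕ) : ackH (k + 1) 3 = ackH k 4 := by
  rw [ackH_succ_succ, ackH_two]

lemma lt_ackH_three (k : ℕ) : k < ackH k 3 := by
  induction k with
  | zero =>
    rw [ackH]
    norm_num
  | succ k ih =>
    rw [ackH_succ_three]
    have := ackH_strictMono k (show 3 < 4 by norm_num)
    omega

lemma ackA_mono : Monotone ackA := fun _ _ h => ackH_mono_left (by omega) 3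

lemma alphaA_mem (r : ℝ) : 1 ≤ alphaA r ∧ r ≤ ackA (alphaA r) := by
  have hne : {n : ℕ | 1 ≤ n ∧ r ≤ ackA n}.Nonempty := by
    refine ⟨⌈r⌉₊ + 1, by omega, (Nat.le_ceil r).trans ?_⟩
    exact_mod_cast (lt_ackH_three ⌈r⌉₊).le
  exact Nat.sInf_mem hne

lemma le_alphaA {n : ℕ} {r : ℝ} (h : (ackA n : ℝ) < r) : n ≤ alphaA r := by
  by_contra! hlt
  have h1 := (alphaA_mem r).2
  have h2 : (ackA (alphaA r) : ℝ) ≤ ackA n := by exact_mod_cast ackA_mono hlt.le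
  linarith

lemma ackA_lt_of_lt_alphaA {n : ℕ} {r : ℝ} (hn : 1 ≤ n) (h : n < alphaA r) : (ackA n : ℝ) < r := by
  have := Nat.notMem_of_lt_sInf h
  by_contra! hle
  exact this ⟨hn, hle⟩

lemma AckermannUnstabbed.exists_le {d : ℕ} {q : ℕ → ℕ} (h : AckermannUnstabbed d q) :
    ∃ n₀ : ℕ, ∀ r : ℝ, n₀ ≤ alphaA r →
      ∃ F : ℕ, (F : ℝ) ≤ r ∧ LeavesUnstabbed d (q (alphaA r - 6)) 1 F := by
  obtain ⟨e, he⟩ := h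
  refine ⟨e + 6, fun r hr => ?_⟩
  set m := alphaA r - 6 with hm
  obtain ⟨F, hF, hun⟩ := he m 1 one_pos
  refine ⟨F, ?_, hun⟩
  have h1 : (ackA (alphaA r - 1) : ℝ) < r := ackA_lt_of_lt_alphaA (by omega) (by omega)
  have h2 : F ≤ ackA (alphaA r - 1) := by
    calc F ≤ (ackH (m + 1))^[e] (ackH (m + 1 + 1) 0) := by rwa [ackH_succ_zero]
      _ = ackH (m + 2) e := by rw [← ackH_succ_add, zero_add]
      _ ≤ ackH (m + 2) (ackH (m + 3) 3) := by
        refine (ackH_strictMono _).monotone ?_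
        have := lt_ackH_three (m + 3)
        omega
      _ = ackH (m + 4) 3 := by rw [ackH_succ_three (m + 3), ← ackH_succ_succ]
      _ = ackA (alphaA r - 1) := by
        rw [ackA]
        congr 1
        omega
  have h3 : (F : ℝ) ≤ ackA (alphaA r - 1) := by exact_mod_cast h2
  linarith

lemma exists_curve_of_leavesUnstabbed {d κ F : ℕ} {r : ℝ} (hd : 0 < d) (hκ : 2 ≤ κ)
    (h : LeavesUnstabbed d κ 1 F) (hFr : (F : ℝ) ≤ r) :
    ∃ c : Fin d → ℝ, (∀ i, 0 < c i) ∧ (∀ i, c i ≠ 1) ∧ Function.Injective c ∧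
      ∃ X : Finset (Fin d → ℝ), X.Nonempty ∧
        (∀ x ∈ X, ∃ s : ℝ, ∀ i, x i = (c i) ^ s) ∧
        ∀ N : Finset (Fin d → ℝ), IsWeakNet X (1 / r) (↑N : Set (Fin d → ℝ)) →
          κ * r ≤ 4 * d * (N.card : ℝ) := by
  classical
  have hF : 0 < F := by have := h.le; omega
  have hFR : (0 : ℝ) < F := by exact_mod_cast hF
  have hr : 0 < r := hFR.trans_le hFr
  have hκR : (2 : ℝ) ≤ κ := by exact_mod_cast hκ
  set y : ℝ := κ * r / (2 * F) with hy
  have hy1 : 1 ≤ y := by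
    rw [hy, le_div_iff₀ (by positivity)]
    nlinarith
  have hyF : y * (2 * F) = κ * r := by rw [hy]; field_simp
  set q := ⌊y⌋₊ with hq
  have hqpos : 0 < q := Nat.floor_pos.mpr hy1
  have hqle : (q : ℝ) ≤ y := Nat.floor_le (by linarith)
  have hqlt : y < q + 1 := Nat.lt_floor_add_one y
  have hq1 : (1 : ℝ) ≤ q := by exact_mod_cast hqpos
  set n := 2 * (q * F) with hn
  have hnpos : 0 < n := by positivity
  have hb : ∀ i, 5 ≤ curveBase n i := fun i => (curveBase_lt_succ hnpos i).1
  refine ⟨fun i => (curveBase n i : ℝ), fun i => ?_, fun i => ?_, fun i k hik => ?_,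
    (Finset.range n).image (curvePoint d n), ?_, fun x hx => ?_, fun N hN => ?_⟩
  · have := hb i
    simpa using (by omega : 0 < curveBase n i)
  · have := hb i
    simpa using (by omega : curveBase n i ≠ 1)
  · exact Fin.ext ((curveBase_strictMono hnpos).injective (by simpa using hik))
  · rw [Finset.image_nonempty, Finset.nonempty_range_iff]
    omega
  · obtain ⟨a, _, rfl⟩ := Finset.mem_image.mp hx
    exact ⟨a, fun i => by rw [Real.rpow_natCast]; rfl⟩
  · have hlt := lt_mul_card_of_isWeakNet hd hF hqpos h hr (by
      rw [← hyF]
      push_cast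
      nlinarith) hN
    have hlt' : (q : ℝ) * F < d * N.card := by exact_mod_cast hlt
    rw [← hyF]
    nlinarith

lemma two_le_cutCount {b : ℕ → ℕ} (hb : ∀ m, 2 ≤ b m) (t m : ℕ) : 2 ≤ cutCount b t m := by
  fun_induction cutCount b t m with
  | case1 m => exact hb m
  | case2 => omega
  | case3 t m ih₁ ih₂ => nlinarith

lemma cutCount_one (m : ℕ) : cutCount (fun m => m + 2) 1 m = (m + 2).factorial := by
  induction m with
  | zero => rw [cutCount_succ_zero]; rfl
  | succ m ih =>
    rw [cutCount_succ_succ, ih, cutCount_zero, show m + 1 + 2 = (m + 2) + 1 by ring,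
      Nat.factorial_succ (m + 2), Nat.mul_comm]

lemma exp_le_four_rpow {x : ℝ} (hx : 0 ≤ x) : Real.exp x ≤ 4 ^ x := by
  rw [Real.rpow_def_of_pos (by norm_num), Real.exp_le_exp]
  have h1 : Real.log 4 = 2 * Real.log 2 := by
    rw [show (4 : ℝ) = 2 ^ (2 : ℕ) by norm_num, Real.log_pow]
    norm_num
  have h2 := Real.log_two_gt_d9
  nlinarith

lemma logb_factorial_ge {x : ℝ} (hx : 1 ≤ x) (m : ℕ) :
    m * Real.logb 2 x - 2 * x ≤ Real.logb 2 m.factorial := by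
  have hx0 : 0 < x := by linarith
  have hf : (0 : ℝ) < m.factorial := by exact_mod_cast m.factorial_pos
  have h1 : x ^ m ≤ m.factorial * (4 : ℝ) ^ x := by
    have := (Real.pow_div_factorial_le_exp x hx0.le m).trans (exp_le_four_rpow hx0.le)
    rw [div_le_iff₀ hf] at this
    linarith
  have h2 := Real.logb_le_logb_of_le (b := 2) (by norm_num) (by positivity) h1
  rw [Real.logb_mul hf.ne' (by positivity), Real.logb_pow, Real.logb_rpow_eq_mul_logb_of_pos
    (by norm_num)] at h2
  have h3 : Real.logb 2 4 = 2 := by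
    rw [show (4 : ℝ) = 2 ^ (2 : ℕ) by norm_num, Real.logb_pow, Real.logb_self_eq_one (by norm_num)]
    norm_num
  rw [h3] at h2
  linarith

lemma logb_two_le_self {x : ℝ} (hx : 1 ≤ x) : Real.logb 2 x ≤ x := by
  rw [Real.logb_le_iff_le_rpow (by norm_num) (by linarith)]
  have h1 : 1 + x * 1 ≤ (1 + 1) ^ x := one_add_mul_self_le_rpow_one_add (by norm_num) hx
  norm_num at h1
  linarith

lemma logb_cutCount_ge {x : ℝ} (hx : 1 ≤ x) (t m : ℕ) :
    Real.logb 2 x * (m + (t + 1)).choose (t + 1) - 2 * x * (m + t).choose t ≤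
      Real.logb 2 (cutCount (fun m => m + 2) (t + 1) m) := by
  have hl : 0 ≤ Real.logb 2 x := Real.logb_nonneg (by norm_num) hx
  induction t generalizing m with
  | zero =>
    rw [cutCount_one]
    have h1 := logb_factorial_ge hx (m + 1)
    have h2 : Real.logb 2 (m + 1).factorial ≤ Real.logb 2 (m + 2).factorial := by
      refine Real.logb_le_logb_of_le (by norm_num) (by exact_mod_cast Nat.factorial_pos _) ?_
      exact_mod_cast Nat.factorial_le (by omega)
    simp only [zero_add, Nat.choose_one_right, Nat.choose_zero_right]
    push_cast at h1 ⊢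
    linarith
  | succ t iht =>
    induction m with
    | zero =>
      rw [cutCount_succ_zero]
      have := logb_two_le_self hx
      simp only [zero_add, Nat.choose_self, Nat.cast_one, mul_one, Nat.cast_ofNat]
      rw [Real.logb_self_eq_one (by norm_num)]
      linarith
    | succ m ihm =>
      have hpos := fun t m => cutCount_pos (b := fun m => m + 2) (fun m => by omega) t m
      rw [cutCount_succ_succ, Nat.cast_mul, Real.logb_mul
        (by exact_mod_cast (hpos _ _).ne') (by exact_mod_cast (hpos _ _).ne')]
      have h1 := iht (m + 1)
      have e1 : (m + 1 + (t + 1 + 1)).choose (t + 1 + 1) =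
          (m + 1 + (t + 1)).choose (t + 1) + (m + (t + 1 + 1)).choose (t + 1 + 1) := by
        rw [show m + 1 + (t + 1 + 1) = (m + (t + 1 + 1)) + 1 by ring, Nat.choose_succ_succ',
          show m + (t + 1 + 1) = m + 1 + (t + 1) by ring]
      have e2 : (m + 1 + (t + 1)).choose (t + 1) =
          (m + 1 + t).choose t + (m + (t + 1)).choose (t + 1) := by
        rw [show m + 1 + (t + 1) = (m + (t + 1)) + 1 by ring, Nat.choose_succ_succ',
          show m + (t + 1) = m + 1 + t by ring]
      have e1' : ((m + 1 + (t + 1 + 1)).choose (t + 1 + 1) : ℝ) =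
          (m + 1 + (t + 1)).choose (t + 1) + (m + (t + 1 + 1)).choose (t + 1 + 1) := by
        exact_mod_cast e1
      have e2' : ((m + 1 + (t + 1)).choose (t + 1) : ℝ) =
          (m + 1 + t).choose t + (m + (t + 1)).choose (t + 1) := by
        exact_mod_cast e2
      rw [e1', mul_add]
      have e3 : 2 * x * ((m + 1 + (t + 1)).choose (t + 1) : ℝ) =
          2 * x * (m + 1 + t).choose t + 2 * x * (m + (t + 1)).choose (t + 1) := by
        rw [e2', mul_add]
      linarith

lemma choose_ge {t a : ℕ} (ha : 6 ≤ a) :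
    (a : ℝ) ^ t / t.factorial * (1 - 5 * t / a) ≤ (a - 6 + t).choose t := by
  have h1 := Nat.pow_le_choose (α := ℝ) t (a - 6 + t)
  have e1 : ((a - 6 + t + 1 - t : ℕ) : ℝ) = a - 5 := by
    rw [show a - 6 + t + 1 - t = a - 5 by omega, Nat.cast_sub (by omega)]
    norm_num
  rw [e1] at h1
  refine le_trans ?_ h1
  have haR : (6 : ℝ) ≤ a := by exact_mod_cast ha
  have h2 : 1 + (t : ℝ) * (-5 / a) ≤ (1 + -5 / a) ^ t := by
    refine one_add_mul_le_pow ?_ t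
    rw [le_div_iff₀ (by linarith)]
    linarith
  have h3 : (a : ℝ) - 5 = a * (1 + -5 / a) := by field_simp; ring
  rw [h3, mul_pow, div_mul_eq_mul_div]
  gcongr
  calc 1 - 5 * (t : ℝ) / a = 1 + (t : ℝ) * (-5 / a) := by ring
    _ ≤ _ := h2

lemma even_exponent_le {t a : ℕ} {l : ℝ} (ht : 1 ≤ t) (ha : 6 ≤ a) (hl : 0 ≤ l) :
    l + (1 - (5 * t + t.factorial * l) * (1 / a)) * ((a : ℝ) ^ t / t.factorial) ≤
      (a - 6 + t).choose t := by
  refine le_trans ?_ (choose_ge ha)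
  have haR : (6 : ℝ) ≤ a := by exact_mod_cast ha
  have hf : (0 : ℝ) < t.factorial := by exact_mod_cast t.factorial_pos
  have h1 : (a : ℝ) ≤ a ^ t := le_self_pow₀ (by linarith) (by omega)
  have h2 : l ≤ l * (a ^ t / a) := by
    refine le_mul_of_one_le_right hl ?_
    rwa [le_div_iff₀ (by linarith), one_mul]
  have h3 : t.factorial * l * (1 / a) * ((a : ℝ) ^ t / t.factorial) = l * (a ^ t / a) := by
    field_simp
  have h4 : (1 - (5 * t + t.factorial * l) * (1 / a)) * ((a : ℝ) ^ t / t.factorial) =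
      (a : ℝ) ^ t / t.factorial * (1 - 5 * t / a) -
        t.factorial * l * (1 / a) * ((a : ℝ) ^ t / t.factorial) := by ring
  rw [h4, h3]
  linarith

lemma odd_exponent_le {t a : ℕ} {l : ℝ} (ha : 8 ≤ a) (hat : t ≤ a) (hl : 0 ≤ l) :
    l + (Real.logb 2 a - (1 + 5 * t + 2 ^ t * t.factorial + t.factorial * l)) *
        ((a : ℝ) ^ t / t.factorial) ≤
      Real.logb 2 (cutCount (fun m => m + 2) t (a - 6)) := by
  have haR : (8 : ℝ) ≤ a := by exact_mod_cast ha
  cases t with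
  | zero =>
    rw [cutCount_zero, show a - 6 + 2 = a - 4 by omega]
    have h1 : Real.logb 2 (a / 2) ≤ Real.logb 2 ((a - 4 : ℕ) : ℝ) := by
      refine Real.logb_le_logb_of_le (by norm_num) (by linarith) ?_
      rw [Nat.cast_sub (by omega)]
      push_cast
      linarith
    rw [Real.logb_div (by linarith) (by norm_num), Real.logb_self_eq_one (by norm_num)] at h1
    simp only [Nat.cast_zero, pow_zero, Nat.factorial_zero, Nat.cast_one, mul_zero, mul_one,
      one_mul, div_one]
    linarith
  | succ t =>
    refine le_trans ?_ (logb_cutCount_ge (x := a) (by linarith) t (a - 6))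
    set L := Real.logb 2 a with hL
    have hL0 : 0 ≤ L := Real.logb_nonneg (by norm_num) (by linarith)
    have hLa : L ≤ a := logb_two_le_self (by linarith)
    have hf : (0 : ℝ) < (t + 1).factorial := by exact_mod_cast (t + 1).factorial_pos
    set B : ℝ := (a : ℝ) ^ (t + 1) / (t + 1).factorial with hB
    have hB0 : 0 < B := by positivity
    have hBf : B * (t + 1).factorial = (a : ℝ) ^ (t + 1) := by rw [hB]; field_simp
    have h1 : L * (B * (1 - 5 * (t + 1 : ℕ) / a)) ≤
        L * (a - 6 + (t + 1)).choose (t + 1) :=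
      mul_le_mul_of_nonneg_left (choose_ge (by omega)) hL0
    have h2 : 2 * (a : ℝ) * (a - 6 + t).choose t ≤ 2 ^ (t + 1) * a ^ (t + 1) := by
      have h3 : (a - 6 + t).choose t ≤ (2 * a) ^ t :=
        (Nat.choose_le_pow _ _).trans (Nat.pow_le_pow_left (by omega) t)
      have h3' : ((a - 6 + t).choose t : ℝ) ≤ (2 * a) ^ t := by exact_mod_cast h3
      calc 2 * (a : ℝ) * (a - 6 + t).choose t ≤ 2 * a * (2 * a) ^ t := by gcongr
        _ = _ := by rw [← mul_pow]; ring
    have h4 : L * (5 * (t + 1 : ℕ) / a) ≤ 5 * (t + 1 : ℕ) := by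
      rw [mul_div_assoc', div_le_iff₀ (by linarith)]
      nlinarith [Nat.cast_nonneg (α := ℝ) (t + 1)]
    have h5 : l ≤ B * ((t + 1).factorial * l) := by
      rw [← mul_assoc, hBf]
      exact le_mul_of_one_le_left hl (one_le_pow₀ (by linarith))
    have h6 : 2 ^ (t + 1) * (a : ℝ) ^ (t + 1) = B * (2 ^ (t + 1) * (t + 1).factorial) := by
      rw [← hBf]; ring
    have h7 : B * (L * (5 * (t + 1 : ℕ) / a)) ≤ B * (5 * (t + 1 : ℕ)) :=
      mul_le_mul_of_nonneg_left h4 hB0.le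
    nlinarith

/-- Transfer from unstabbed cuts to weak nets, given the numerical bound on the cuts. -/
lemma AckermannUnstabbed.exists_curve {d n₁ : ℕ} {q : ℕ → ℕ} {E : ℝ → ℝ} (hd : 0 < d)
    (h : AckermannUnstabbed d q) (hq : ∀ m, 2 ≤ q m)
    (hE : ∀ r, n₁ ≤ alphaA r → Real.logb 2 (4 * d) + E r ≤ Real.logb 2 (q (alphaA r - 6))) :
    ∃ r₀ : ℝ, ∀ r : ℝ, r₀ ≤ r →
      ∃ c : Fin d → ℝ, (∀ i, 0 < c i) ∧ (∀ i, c i ≠ 1) ∧ Function.Injective c ∧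
        ∃ X : Finset (Fin d → ℝ), X.Nonempty ∧
          (∀ x ∈ X, ∃ s : ℝ, ∀ i, x i = (c i) ^ s) ∧
          ∀ N : Finset (Fin d → ℝ), IsWeakNet X (1 / r) (↑N : Set (Fin d → ℝ)) →
            r * (2 : ℝ) ^ E r ≤ (N.card : ℝ) := by
  obtain ⟨n₀, hn₀⟩ := h.exists_le
  refine ⟨ackA (max n₀ n₁) + 1, fun r hr => ?_⟩
  have hα : max n₀ n₁ ≤ alphaA r := le_alphaA (by linarith)
  have hr0 : 0 < r := by
    have : (0 : ℝ) ≤ ackA (max n₀ n₁) := Nat.cast_nonneg _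
    linarith
  obtain ⟨F, hFr, hun⟩ := hn₀ r ((le_max_left _ _).trans hα)
  obtain ⟨c, hc₀, hc₁, hci, X, hX, hXc, hXN⟩ := exists_curve_of_leavesUnstabbed hd (hq _) hun hFr
  refine ⟨c, hc₀, hc₁, hci, X, hX, hXc, fun N hN => ?_⟩
  have hnet := hXN N hN
  have hdR : (0 : ℝ) < 4 * d := by
    have : (0 : ℝ) < d := by exact_mod_cast hd
    linarith
  set κ := q (alphaA r - 6) with hκ
  have hκ0 : (0 : ℝ) < κ := by
    have := hq (alphaA r - 6)
    exact_mod_cast (show 0 < κ by omega)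
  have hle : 4 * d * (2 : ℝ) ^ E r ≤ κ := by
    have h1 := Real.rpow_le_rpow_of_exponent_le (x := 2) (by norm_num)
      (hE r ((le_max_right _ _).trans hα))
    rwa [Real.rpow_add (by norm_num), Real.rpow_logb (by norm_num) (by norm_num) hdR,
      Real.rpow_logb (by norm_num) (by norm_num) hκ0] at h1
  refine le_of_mul_le_mul_left ?_ hdR
  calc 4 * d * (r * (2 : ℝ) ^ E r) = 4 * d * (2 : ℝ) ^ E r * r := by ring
    _ ≤ κ * r := by gcongr
    _ ≤ _ := hnet

/-- Lower bound for weak `1/r`-nets for point sets on a convex curve: for every `d ≥ 3`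
and all large `r` there is a finite set `X` on a curve `{(c_1^s, …, c_d^s) : s ∈ ℝ}`
every weak `1/r`-net of which has at least `r · 2^{(1 - C·δ_d(r))·β_d(r)}` points. -/
theorem weak_net_diagonal_lower_bound (d : ℕ) (hd : 3 ≤ d) :
    ∃ C : ℝ, 0 < C ∧ ∃ r₀ : ℝ, ∀ r : ℝ, r₀ ≤ r →
      ∃ c : Fin d → ℝ, (∀ i, 0 < c i) ∧ (∀ i, c i ≠ 1) ∧ Function.Injective c ∧
        ∃ X : Finset (Fin d → ℝ), X.Nonempty ∧
          (∀ x ∈ X, ∃ s : ℝ, ∀ i, x i = (c i) ^ s) ∧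
          ∀ N : Finset (Fin d → ℝ), IsWeakNet X (1 / r) (↑N : Set (Fin d → ℝ)) →
            r * (2 : ℝ) ^ ((1 - C * deltaD d r) * betaD d r) ≤ (N.card : ℝ) := by
  set t := d / 2 - 1 with ht
  set l := Real.logb 2 (4 * d) with hl
  have hl0 : 0 ≤ l := by
    refine Real.logb_nonneg (by norm_num) ?_
    have : (3 : ℝ) ≤ d := by exact_mod_cast hd
    linarith
  have hf : (0 : ℝ) < t.factorial := by exact_mod_cast t.factorial_pos
  by_cases hpar : d % 2 = 0
  · have ht1 : 1 ≤ t := by omega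
    have hun := ackermannUnstabbed_two.raise le_rfl (fun _ => two_pos) t
    rw [show 2 + 2 * t = d by omega] at hun
    have ht1R : (1 : ℝ) ≤ t := by exact_mod_cast ht1
    refine ⟨5 * t + t.factorial * l, by positivity, hun.exists_curve (n₁ := 6) (by omega)
      (two_le_cutCount (fun _ => le_rfl) t) fun r hr => ?_⟩
    rw [deltaD, betaD, if_pos hpar, if_pos hpar, ← ht, ← hl, cutCount_two, Nat.cast_pow,
      Nat.cast_ofNat, Real.logb_pow, Real.logb_self_eq_one (by norm_num), mul_one]
    exact even_exponent_le ht1 hr hl0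
  · have hun := ackermannUnstabbed_three.raise (by norm_num) (fun _ => by omega) t
    rw [show 3 + 2 * t = d by omega] at hun
    refine ⟨1 + 5 * t + 2 ^ t * t.factorial + t.factorial * l, by positivity,
      hun.exists_curve (n₁ := 8 + t) (by omega) (two_le_cutCount (fun _ => by omega) t)
      fun r hr => ?_⟩
    rw [deltaD, betaD, if_neg hpar, if_neg hpar, ← ht, ← hl]
    refine le_trans (le_of_eq ?_) (odd_exponent_le (l := l) (by omega) (by omega) hl0)
    have hα : (1 : ℝ) < alphaA r := by exact_mod_cast (show 1 < alphaA r by omega)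
    have hlog : Real.logb 2 (alphaA r) ≠ 0 := (Real.logb_pos (by norm_num) hα).ne'
    congr 1
    field_simp
end

section
/- There exist a constant C > 0 and an integer m_0 such that the following holds. For every integer m ≥ m_0, setting n = m², and for every integer t with n^{5/2}·log n ≤ t ≤ C(n,3) = n(n−1)(n−2)/6, there exist an n-point set X ⊂ ℝ² and a family T of t distinct 3-element subsets (triangles) of X such that every point q ∈ ℝ² is contained in the convex hulls of at most C · t² / (n³ · log(n³/t)) members of T. -/
/-- The point in column `i` and row `j` of the stretched grid with ratio `K`: columns are equally
spaced, and the heights of the rows grow geometrically. -/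
def stretchedPoint (K : ℝ) (i j : ℕ) : ℝ × ℝ := (i, K ^ j)

lemma stretchedPoint_inj {K : ℝ} (hK : 1 < K) {i j i' j' : ℕ}
    (h : stretchedPoint K i j = stretchedPoint K i' j') : i = i' ∧ j = j' := by
  simp only [stretchedPoint, Prod.mk.injEq, Nat.cast_inj] at h
  exact ⟨h.1, pow_right_injective₀ (by linarith) hK.ne' h.2⟩

open Classical in
/-- The `m × m` stretched grid with ratio `K`. -/
noncomputable def stretchedGrid (K : ℝ) (m : ℕ) : Finset (ℝ × ℝ) :=
  (Finset.range m ×ˢ Finset.range m).image fun p => stretchedPoint K p.1 p.2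

lemma card_stretchedGrid {K : ℝ} (hK : 1 < K) (m : ℕ) : (stretchedGrid K m).card = m ^ 2 := by
  classical
  rw [stretchedGrid, Finset.card_image_of_injective, Finset.card_product, Finset.card_range, sq]
  rintro ⟨i, j⟩ ⟨i', j'⟩ h
  exact Prod.ext_iff.2 (stretchedPoint_inj hK h)

lemma stretchedPoint_mem_stretchedGrid (K : ℝ) {i j m : ℕ} (hi : i < m) (hj : j < m) :
    stretchedPoint K i j ∈ stretchedGrid K m := by
  classical
  exact Finset.mem_image.2 ⟨(i, j), by simp [hi, hj], rfl⟩

lemma exists_weights_of_mem_convexHull_triple {E : Type*} [AddCommGroup E] [Module ℝ E]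
    {p₁ p₂ p₃ q : E} (hq : q ∈ convexHull ℝ ({p₁, p₂, p₃} : Set E)) :
    ∃ α β γ : ℝ, 0 ≤ α ∧ 0 ≤ β ∧ 0 ≤ γ ∧ α + β + γ = 1 ∧ α • p₁ + β • p₂ + γ • p₃ = q := by
  rw [convexHull_insert (Set.insert_nonempty _ _), convexHull_pair] at hq
  simp only [convexJoin_singleton_left, Set.mem_iUnion] at hq
  obtain ⟨p, ⟨s, r, hs, hr, hsr, rfl⟩, u, v, hu, hv, huv, rfl⟩ := hq
  refine ⟨u, v * s, v * r, hu, by positivity, by positivity, ?_, ?_⟩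
  · linear_combination huv + v * hsr
  · simp only [smul_add, smul_smul, add_assoc]

/-- A point `q` determines a column `I` and a row `J` such that every triangle of the stretched
grid whose vertices ascend from left to right and which contains `q` has its first vertex in
column `I`, or its last vertex in row `J`, or spans a box around the cell `(I, J)`. -/
lemma exists_cell_of_mem_convexHull {m : ℕ} (hm : 1 ≤ m) (q : ℝ × ℝ) :
    ∃ I J : ℕ, ∀ a₁ a₂ b₁ b₂ c₁ c₂ : ℕ, a₁ < b₁ → b₁ < c₁ → c₁ < m →
      a₂ < b₂ → b₂ < c₂ →
      q ∈ convexHull ℝ ({stretchedPoint (2 * m) a₁ a₂, stretchedPoint (2 * m) b₁ b₂,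
        stretchedPoint (2 * m) c₁ c₂} : Set (ℝ × ℝ)) →
      a₁ = I ∨ c₂ = J ∨ (a₁ < I ∧ I ≤ b₁ ∧ b₂ ≤ J + 1 ∧ J < c₂) := by
  obtain ⟨x, y⟩ := q
  have hm' : (1 : ℝ) ≤ m := by exact_mod_cast hm
  set K : ℝ := 2 * m with hKdef
  have hK : 1 < K := by linarith
  have hex : ∃ j : ℕ, y ≤ K ^ j := (pow_unbounded_of_one_lt y hK).imp fun _ h => h.le
  refine ⟨⌊x⌋₊, Nat.find hex, fun a₁ a₂ b₁ b₂ c₁ c₂ hab hbc hcm hab₂ hbc₂ hq => ?_⟩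
  obtain ⟨α, β, γ, hα, hβ, hγ, hsum, h⟩ := exists_weights_of_mem_convexHull_triple hq
  simp only [stretchedPoint, Prod.smul_mk, Prod.mk_add_mk, smul_eq_mul, Prod.mk.injEq] at h
  obtain ⟨hx, hy⟩ := h
  have hab' : (a₁ : ℝ) + 1 ≤ b₁ := by exact_mod_cast hab
  have hbc' : (b₁ : ℝ) + 1 ≤ c₁ := by exact_mod_cast hbc
  have hcm' : (c₁ : ℝ) + 1 ≤ m := by exact_mod_cast hcm
  have ha0 : (0 : ℝ) ≤ a₁ := a₁.cast_nonneg
  have hK0 : 0 < K := by linarith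
  have hyc : y ≤ K ^ c₂ := by
    have h1 : K ^ a₂ ≤ K ^ c₂ := pow_le_pow_right₀ hK.le (by omega)
    have h2 : K ^ b₂ ≤ K ^ c₂ := pow_le_pow_right₀ hK.le (by omega)
    calc y = α * K ^ a₂ + β * K ^ b₂ + γ * K ^ c₂ := hy.symm
      _ ≤ α * K ^ c₂ + β * K ^ c₂ + γ * K ^ c₂ := by gcongr
      _ = K ^ c₂ := by rw [← add_mul, ← add_mul, hsum, one_mul]
  have hJc : Nat.find hex ≤ c₂ := Nat.find_min' hex hyc
  have hax : (a₁ : ℝ) ≤ x := by nlinarith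
  have haI : a₁ ≤ ⌊x⌋₊ := Nat.le_floor hax
  rcases haI.eq_or_lt with h | haI
  · exact Or.inl h
  rcases hJc.eq_or_lt with h | hJc
  · exact Or.inr (Or.inl h.symm)
  refine Or.inr (Or.inr ⟨haI, ?_, ?_, hJc⟩)
  all_goals
    have hyJ : y ≤ K ^ Nat.find hex := Nat.find_spec hex
    have hγK : γ * K ≤ 1 := by
      obtain ⟨c, rfl⟩ : ∃ c, c₂ = c + 1 := ⟨c₂ - 1, by omega⟩
      have h1 : y ≤ K ^ c := hyJ.trans (pow_le_pow_right₀ hK.le (by omega))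
      have h2 : 0 < K ^ c := by positivity
      have h3 : γ * K * K ^ c ≤ 1 * K ^ c := by
        have : 0 ≤ α * K ^ a₂ + β * K ^ b₂ := by positivity
        rw [pow_succ] at hy
        linarith
      exact le_of_mul_le_mul_right h3 h2
    have hγm : γ * m ≤ 1 / 2 := by rw [hKdef] at hγK; linarith
    have hγc : γ * c₁ ≤ γ * m := by gcongr
  · have : x < (b₁ : ℝ) + 1 := by nlinarith
    exact Nat.lt_add_one_iff.1 ((Nat.floor_lt (by linarith)).2 (by exact_mod_cast this))
  · have hax1 : (a₁ : ℝ) + 1 ≤ x := by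
      have := (Nat.le_floor_iff (ha0.trans hax)).1 (Nat.succ_le_of_lt haI)
      exact_mod_cast this
    have h1 : 1 / 2 ≤ β * m := by nlinarith
    have hβK : 1 ≤ β * K := by rw [hKdef]; linarith
    have h2 : K ^ b₂ ≤ K ^ (Nat.find hex + 1) := by
      calc K ^ b₂ ≤ (β * K) * K ^ b₂ := le_mul_of_one_le_left (by positivity) hβK
        _ = K * (β * K ^ b₂) := by ring
        _ ≤ K * y := by
          gcongr
          have : 0 ≤ α * K ^ a₂ := by positivity
          have : 0 ≤ γ * K ^ c₂ := by positivity
          linarith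
        _ ≤ K * K ^ Nat.find hex := by gcongr
        _ = K ^ (Nat.find hex + 1) := by ring
    exact (pow_le_pow_iff_right₀ hK).1 h2

lemma triple_eq_of_fst_lt [DecidableEq (ℝ × ℝ)] {a b c a' b' c' : ℝ × ℝ}
    (hab : a.1 < b.1) (hbc : b.1 < c.1) (hab' : a'.1 < b'.1) (hbc' : b'.1 < c'.1)
    (h : ({a, b, c} : Finset (ℝ × ℝ)) = {a', b', c'}) : a = a' ∧ b = b' ∧ c = c' := by
  have ha : a ∈ ({a', b', c'} : Finset (ℝ × ℝ)) := by simp [← h]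
  have hb : b ∈ ({a', b', c'} : Finset (ℝ × ℝ)) := by simp [← h]
  have hc : c ∈ ({a', b', c'} : Finset (ℝ × ℝ)) := by simp [← h]
  simp only [Finset.mem_insert, Finset.mem_singleton] at ha hb hc
  grind

/-- Parameters of a triangle: the width `w` and height `h` of the box it spans, then the row of
its first vertex, the column of its last vertex, and the column and row of the lower left corner
of the box. -/
abbrev BoxIndex : Type := Σ _ : (Σ _ : ℕ, ℕ), ℕ × ℕ × ℕ × ℕ

/-- Widths in `R` and heights up to `L w`. -/
def boxShapes (R : Finset ℕ) (L : ℕ → ℕ) : Finset (Σ _ : ℕ, ℕ) :=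
  R.sigma fun w => Finset.Icc 1 (L w)

/-- The parameters of all triangles spanning a box of one of the given shapes. -/
def boxIndices (M : ℕ) (R : Finset ℕ) (L : ℕ → ℕ) : Finset BoxIndex :=
  (boxShapes R L).sigma fun _ =>
    Finset.range M ×ˢ Finset.Ico (2 * M) (3 * M) ×ˢ Finset.range M ×ˢ Finset.Ico M (2 * M)

open Classical in
/-- The triangle of the stretched grid with the given parameters. -/
noncomputable def boxTriangle (K : ℝ) : BoxIndex → Finset (ℝ × ℝ)
  | ⟨⟨w, h⟩, a₂, c₁, a₁, b₂⟩ =>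
    {stretchedPoint K a₁ a₂, stretchedPoint K (a₁ + w) b₂, stretchedPoint K c₁ (b₂ + h)}

lemma mem_boxIndices {M : ℕ} {R : Finset ℕ} {L : ℕ → ℕ} {w h a₂ c₁ a₁ b₂ : ℕ} :
    (⟨⟨w, h⟩, a₂, c₁, a₁, b₂⟩ : BoxIndex) ∈ boxIndices M R L ↔
      (w ∈ R ∧ 1 ≤ h ∧ h ≤ L w) ∧ a₂ < M ∧ (2 * M ≤ c₁ ∧ c₁ < 3 * M) ∧ a₁ < M ∧
        M ≤ b₂ ∧ b₂ < 2 * M := by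
  simp [boxIndices, boxShapes]

lemma card_boxShapes (R : Finset ℕ) (L : ℕ → ℕ) : (boxShapes R L).card = ∑ w ∈ R, L w := by
  simp [boxShapes]

lemma card_boxIndices (M : ℕ) (R : Finset ℕ) (L : ℕ → ℕ) :
    (boxIndices M R L).card = M ^ 4 * ∑ w ∈ R, L w := by
  have h1 : 3 * M - 2 * M = M := by omega
  have h2 : 2 * M - M = M := by omega
  simp only [boxIndices, Finset.card_sigma, Finset.card_product, Finset.card_range,
    Nat.card_Ico, h1, h2, Finset.sum_const, smul_eq_mul, card_boxShapes]
  ring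

lemma boxTriangle_injOn {K : ℝ} (hK : 1 < K) {M : ℕ} {R : Finset ℕ} {L : ℕ → ℕ}
    (hR : ∀ w ∈ R, 1 ≤ w ∧ w ≤ M) : Set.InjOn (boxTriangle K) (boxIndices M R L) := by
  classical
  rintro ⟨⟨w, h⟩, a₂, c₁, a₁, b₂⟩ hp ⟨⟨w', h'⟩, a₂', c₁', a₁', b₂'⟩ hp' heq
  rw [Finset.mem_coe, mem_boxIndices] at hp hp'
  have hw := hR w hp.1.1
  have hw' := hR w' hp'.1.1
  have key := triple_eq_of_fst_lt (by simp only [stretchedPoint, Nat.cast_lt]; omega)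
    (by simp only [stretchedPoint, Nat.cast_lt]; omega)
    (by simp only [stretchedPoint, Nat.cast_lt]; omega)
    (by simp only [stretchedPoint, Nat.cast_lt]; omega) heq
  have k1 := stretchedPoint_inj hK key.1
  have k2 := stretchedPoint_inj hK key.2.1
  have k3 := stretchedPoint_inj hK key.2.2
  obtain rfl : w = w' := by omega
  obtain rfl : h = h' := by omega
  rw [k1.1, k1.2, k2.2, k3.1]

lemma boxTriangle_subset_card {K : ℝ} (hK : 1 < K) {m M : ℕ} (hM : 3 * M ≤ m) {R : Finset ℕ}
    {L : ℕ → ℕ} (hR : ∀ w ∈ R, 1 ≤ w ∧ w ≤ M) (hL : ∀ w ∈ R, L w ≤ M) {p : BoxIndex}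
    (hp : p ∈ boxIndices M R L) :
    boxTriangle K p ⊆ stretchedGrid K m ∧ (boxTriangle K p).card = 3 := by
  classical
  obtain ⟨⟨w, h⟩, a₂, c₁, a₁, b₂⟩ := p
  rw [mem_boxIndices] at hp
  have hw := hR w hp.1.1
  have hLw := hL w hp.1.1
  constructor
  · simp only [boxTriangle, Finset.insert_subset_iff, Finset.singleton_subset_iff]
    refine ⟨?_, ?_, ?_⟩ <;> apply stretchedPoint_mem_stretchedGrid <;> omega
  · refine Finset.card_eq_three.2 ⟨_, _, _, ?_, ?_, ?_, rfl⟩ <;>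
      intro he <;> have := stretchedPoint_inj hK he <;> omega

open Classical in
lemma card_filter_mem_convexHull_le {m M : ℕ} (hm : 1 ≤ m) (hM : 3 * M ≤ m) {R : Finset ℕ}
    {L : ℕ → ℕ} (hR : ∀ w ∈ R, 1 ≤ w ∧ w ≤ M) (q : ℝ × ℝ) :
    ((boxIndices M R L).filter fun p =>
        q ∈ convexHull ℝ (↑(boxTriangle (2 * m) p) : Set (ℝ × ℝ))).card ≤
      2 * M ^ 3 * ∑ w ∈ R, L w + 2 * M ^ 2 * ∑ w ∈ R, w * L w ^ 2 := by
  obtain ⟨I, J, hIJ⟩ := exists_cell_of_mem_convexHull hm q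
  have h1 : 3 * M - 2 * M = M := by omega
  have h2 : 2 * M - M = M := by omega
  let B₁ : Finset BoxIndex := (boxShapes R L).sigma fun _ =>
    Finset.range M ×ˢ Finset.Ico (2 * M) (3 * M) ×ˢ {I} ×ˢ Finset.Ico M (2 * M)
  let B₂ : Finset BoxIndex := (boxShapes R L).sigma fun d =>
    Finset.range M ×ˢ Finset.Ico (2 * M) (3 * M) ×ˢ Finset.range M ×ˢ {J - d.2}
  let B₃ : Finset BoxIndex := (boxShapes R L).sigma fun d =>
    Finset.range M ×ˢ Finset.Ico (2 * M) (3 * M) ×ˢ Finset.Ico (I - d.1) I ×ˢ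
      Finset.Ico (J + 1 - d.2) (J + 2)
  have hsub : ((boxIndices M R L).filter fun p =>
      q ∈ convexHull ℝ (↑(boxTriangle (2 * m) p) : Set (ℝ × ℝ))) ⊆ B₁ ∪ B₂ ∪ B₃ := by
    rintro ⟨⟨w, h⟩, a₂, c₁, a₁, b₂⟩ hp
    rw [Finset.mem_filter, mem_boxIndices] at hp
    obtain ⟨hp, hq⟩ := hp
    have hw := hR w hp.1.1
    simp only [boxTriangle, Finset.coe_insert, Finset.coe_singleton] at hq
    have hc := hIJ a₁ a₂ (a₁ + w) b₂ c₁ (b₂ + h) (by omega) (by omega) (by omega) (by omega)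
      (by omega) hq
    simp only [B₁, B₂, B₃, boxShapes, Finset.mem_union, Finset.mem_sigma, Finset.mem_product,
      Finset.mem_range, Finset.mem_Ico, Finset.mem_Icc, Finset.mem_singleton]
    rcases hc with hc | hc | hc
    · exact Or.inl (Or.inl ⟨hp.1, by omega⟩)
    · exact Or.inl (Or.inr ⟨hp.1, by omega⟩)
    · exact Or.inr ⟨hp.1, by omega⟩
  have hB₁ : B₁.card = M ^ 3 * ∑ w ∈ R, L w := by
    simp only [B₁, Finset.card_sigma, Finset.card_product, Finset.card_range,
      Nat.card_Ico, h1, h2, Finset.sum_const, smul_eq_mul, card_boxShapes, Finset.card_singleton]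
    ring
  have hB₂ : B₂.card = M ^ 3 * ∑ w ∈ R, L w := by
    simp only [B₂, Finset.card_sigma, Finset.card_product, Finset.card_range,
      Nat.card_Ico, h1, Finset.sum_const, smul_eq_mul, card_boxShapes, Finset.card_singleton]
    ring
  have hB₃ : B₃.card ≤ 2 * M ^ 2 * ∑ w ∈ R, w * L w ^ 2 := by
    simp only [B₃, boxShapes, Finset.card_sigma, Finset.sum_sigma, Finset.card_product,
      Finset.card_range, Nat.card_Ico, h1, Finset.mul_sum]
    refine Finset.sum_le_sum fun w _ => ?_
    calc ∑ h ∈ Finset.Icc 1 (L w), M * (M * ((I - (I - w)) * (J + 2 - (J + 1 - h))))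
        ≤ ∑ _h ∈ Finset.Icc 1 (L w), M * (M * (w * (2 * L w))) := by
          refine Finset.sum_le_sum fun h hh => ?_
          rw [Finset.mem_Icc] at hh
          gcongr <;> omega
      _ = 2 * M ^ 2 * (w * L w ^ 2) := by
          simp only [Finset.sum_const, Nat.card_Icc, smul_eq_mul, Nat.add_sub_cancel]
          ring
  calc _ ≤ (B₁ ∪ B₂ ∪ B₃).card := Finset.card_le_card hsub
    _ ≤ B₁.card + B₂.card + B₃.card :=
        (Finset.card_union_le _ _).trans (Nat.add_le_add_right (Finset.card_union_le _ _) _)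
    _ ≤ _ := by rw [hB₁, hB₂]; linarith

lemma log_div_le_sum_Icc_inv {a : ℕ} (ha : 1 ≤ a) (b : ℕ) :
    Real.log (((b : ℝ) + 1) / a) ≤ ∑ w ∈ Finset.Icc a b, (w : ℝ)⁻¹ := by
  have ha' : (0 : ℝ) < a := by exact_mod_cast ha
  by_cases hab : b + 1 ≤ a
  · rw [Finset.Icc_eq_empty (by omega), Finset.sum_empty]
    refine Real.log_nonpos (by positivity) ?_
    rw [div_le_one ha']
    exact_mod_cast hab
  · have hab' : a ≤ b := by omega
    induction b, hab' using Nat.le_induction with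
    | base =>
      rw [Finset.Icc_self, Finset.sum_singleton]
      refine (Real.log_le_sub_one_of_pos (by positivity)).trans_eq ?_
      field_simp
      ring
    | succ b hb ih =>
      rw [← Finset.insert_Icc_right_eq_Icc_add_one (by omega), Finset.sum_insert (by simp)]
      have hb0 : (0 : ℝ) < (b : ℝ) + 1 := by positivity
      have h1 : Real.log (((b : ℝ) + 1 + 1) / (b + 1)) ≤ ((b : ℝ) + 1)⁻¹ := by
        refine (Real.log_le_sub_one_of_pos (by positivity)).trans_eq ?_
        field_simp
        ring
      have h2 : Real.log (((b : ℝ) + 1 + 1) / a) =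
          Real.log (((b : ℝ) + 1 + 1) / (b + 1)) + Real.log (((b : ℝ) + 1) / a) := by
        rw [← Real.log_mul (by positivity) (by positivity)]
        congr 1
        field_simp
      push_cast
      rw [h2]
      exact add_le_add h1 (ih (by omega))

lemma sum_Icc_inv_le {a : ℕ} (ha : 1 ≤ a) (b : ℕ) :
    ∑ w ∈ Finset.Icc a b, (w : ℝ)⁻¹ ≤ 1 + Real.log b := by
  refine le_trans ?_ (harmonic_le_one_add_log b)
  rw [harmonic_eq_sum_Icc]
  push_cast
  exact Finset.sum_le_sum_of_subset_of_nonneg (Finset.Icc_subset_Icc_left ha)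
    fun _ _ _ => by positivity

/-- Choice of box shapes: all widths `w` between `1024 t / m ^ 5` and `m / 3`, with heights up to
a multiple of `1 / w`. -/
lemma exists_boxShapes {m t : ℕ} (hm : 12 ≤ m) (ht : (m : ℝ) ^ 5 * (2 * Real.log m) ≤ t)
    (hℓ : 18 ≤ Real.log ((m : ℝ) ^ 6 / t)) :
    ∃ (M : ℕ) (R : Finset ℕ) (L : ℕ → ℕ), 3 * M ≤ m ∧ (∀ w ∈ R, 1 ≤ w ∧ w ≤ M) ∧
      (∀ w ∈ R, L w ≤ M) ∧ t ≤ M ^ 4 * ∑ w ∈ R, L w ∧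
      ((2 * M ^ 3 * ∑ w ∈ R, L w + 2 * M ^ 2 * ∑ w ∈ R, w * L w ^ 2 : ℕ) : ℝ) ≤
        65552 * (t : ℝ) ^ 2 / ((m : ℝ) ^ 6 * Real.log ((m : ℝ) ^ 6 / t)) := by
  have hm' : (12 : ℝ) ≤ m := by exact_mod_cast hm
  have hm0 : (0 : ℝ) < m := by linarith
  have hlogm : 1 ≤ Real.log m := by
    rw [Real.le_log_iff_exp_le hm0]
    linarith [Real.exp_one_lt_three]
  have htm : (m : ℝ) ^ 5 ≤ t := by
    have : 0 < (m : ℝ) ^ 5 := by positivity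
    nlinarith
  have ht0 : (0 : ℝ) < t := lt_of_lt_of_le (by positivity) htm
  set ℓ := Real.log ((m : ℝ) ^ 6 / t)
  have hℓm : ℓ ≤ Real.log m := by
    refine Real.log_le_log (by positivity) ?_
    rw [div_le_iff₀ ht0]
    calc (m : ℝ) ^ 6 = (m : ℝ) * m ^ 5 := by ring
      _ ≤ (m : ℝ) * t := by gcongr
  obtain ⟨M, hM⟩ : ∃ M : ℕ, M = m / 3 := ⟨_, rfl⟩
  have hM3 : 3 * M ≤ m := by omega
  have hM4 : m ≤ 4 * M := by omega
  have hM3' : 3 * (M : ℝ) ≤ m := by exact_mod_cast hM3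
  have hM4' : (m : ℝ) ≤ 4 * M := by exact_mod_cast hM4
  have hM0 : (0 : ℝ) < M := by linarith
  set W := ⌈1024 * (t : ℝ) / m ^ 5⌉₊
  have hWl : 1024 * (t : ℝ) / m ^ 5 ≤ W := Nat.le_ceil _
  have hW0 : (0 : ℝ) < W := lt_of_lt_of_le (by positivity) hWl
  have hW1 : 1 ≤ W := by exact_mod_cast hW0
  have hWu : (W : ℝ) ≤ 1025 * t / m ^ 5 := by
    have h1 : 1 ≤ (t : ℝ) / m ^ 5 := by rwa [le_div_iff₀ (by positivity), one_mul]
    have h2 := (Nat.ceil_lt_add_one (a := 1024 * (t : ℝ) / m ^ 5) (by positivity)).le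
    calc (W : ℝ) ≤ 1024 * (t : ℝ) / m ^ 5 + 1 := h2
      _ ≤ 1024 * (t : ℝ) / m ^ 5 + t / m ^ 5 := by gcongr
      _ = 1025 * t / m ^ 5 := by ring
  set R := Finset.Icc W M with hR
  set H := ∑ w ∈ R, (w : ℝ)⁻¹ with hH
  have hHl : ℓ / 2 ≤ H := by
    have h1 : (m : ℝ) ^ 6 / t / 4100 ≤ ((M : ℝ) + 1) / W := by
      rw [le_div_iff₀ hW0]
      calc (m : ℝ) ^ 6 / t / 4100 * W ≤ (m : ℝ) ^ 6 / t / 4100 * (1025 * t / m ^ 5) := by gcongr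
        _ = (m : ℝ) / 4 := by field_simp; norm_num
        _ ≤ (M : ℝ) + 1 := by linarith
    have h2 : Real.log 4100 ≤ 9 := by
      rw [Real.log_le_iff_le_exp (by norm_num)]
      calc (4100 : ℝ) ≤ 2.7 ^ 9 := by norm_num
        _ ≤ Real.exp 1 ^ 9 := by
          gcongr
          linarith [Real.exp_one_gt_d9]
        _ = Real.exp 9 := by rw [← Real.exp_nat_mul]; norm_num
    have h3 := Real.log_le_log (by positivity) h1
    rw [Real.log_div (by positivity) (by norm_num)] at h3
    have h4 := log_div_le_sum_Icc_inv hW1 M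
    linarith
  have hHu : H ≤ Real.log m := by
    have h1 : 1 ≤ Real.log 3 := by
      rw [Real.le_log_iff_exp_le (by norm_num)]
      exact Real.exp_one_lt_three.le
    calc H ≤ 1 + Real.log M := sum_Icc_inv_le hW1 M
      _ ≤ Real.log 3 + Real.log M := by gcongr
      _ = Real.log (3 * M) := (Real.log_mul (by norm_num) hM0.ne').symm
      _ ≤ Real.log m := Real.log_le_log (by positivity) hM3'
  have hH9 : 9 ≤ H := by linarith
  have hH0 : 0 < H := by linarith
  set S := (t : ℝ) / (M ^ 4 * H) with hS
  have hS0 : 0 < S := by positivity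
  have hSH : S * H = t / M ^ 4 := by rw [hS]; field_simp
  have hSM : (M : ℝ) ≤ S := by
    rw [hS, le_div_iff₀ (by positivity)]
    calc (M : ℝ) * (M ^ 4 * H) = M ^ 5 * H := by ring
      _ ≤ (m : ℝ) ^ 5 * (2 * Real.log m) := by gcongr <;> linarith
      _ ≤ t := ht
  have hSW : S ≤ W * M := by
    rw [hS, div_le_iff₀ (by positivity)]
    have h1 : 1024 * (t : ℝ) ≤ W * m ^ 5 := (div_le_iff₀ (by positivity)).1 hWl
    have h2 : (m : ℝ) ^ 5 ≤ (4 * M) ^ 5 := by gcongr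
    have h3 : (t : ℝ) ≤ W * M ^ 5 * 1 := by nlinarith
    calc (t : ℝ) ≤ W * M ^ 5 * 1 := h3
      _ ≤ W * M ^ 5 * H := by gcongr; linarith
      _ = W * M * (M ^ 4 * H) := by ring
  have hRpos : ∀ w ∈ R, (0 : ℝ) < w := fun w hw => by
    have := (Finset.mem_Icc.1 hw).1
    exact_mod_cast hW1.trans this
  have hLl : ∀ w ∈ R, S * (w : ℝ)⁻¹ ≤ ⌈S / w⌉₊ := fun w _ => by
    rw [← div_eq_mul_inv]
    exact Nat.le_ceil _
  have hLu : ∀ w ∈ R, (⌈S / w⌉₊ : ℝ) ≤ 2 * S * (w : ℝ)⁻¹ := fun w hw => by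
    have h0 := hRpos w hw
    have h1 : (w : ℝ) ≤ M := by exact_mod_cast (Finset.mem_Icc.1 hw).2
    have h2 : 1 ≤ S / w := by
      rw [le_div_iff₀ h0]
      linarith
    have h3 := Nat.ceil_lt_add_one (a := S / w) (by positivity)
    rw [mul_assoc, ← div_eq_mul_inv]
    linarith
  have hsumL : ∑ w ∈ R, (⌈S / w⌉₊ : ℝ) ≤ 2 * (t / M ^ 4) := by
    calc ∑ w ∈ R, (⌈S / w⌉₊ : ℝ) ≤ ∑ w ∈ R, 2 * S * (w : ℝ)⁻¹ := Finset.sum_le_sum hLu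
      _ = 2 * (S * H) := by rw [← Finset.mul_sum, hH]; ring
      _ = 2 * (t / M ^ 4) := by rw [hSH]
  have hsumL2 : ∑ w ∈ R, (w : ℝ) * (⌈S / w⌉₊ : ℝ) ^ 2 ≤ 4 * (t ^ 2 / (M ^ 8 * H)) := by
    calc ∑ w ∈ R, (w : ℝ) * (⌈S / w⌉₊ : ℝ) ^ 2 ≤ ∑ w ∈ R, 4 * S ^ 2 * (w : ℝ)⁻¹ := by
          refine Finset.sum_le_sum fun w hw => ?_
          have h0 := hRpos w hw
          calc (w : ℝ) * (⌈S / w⌉₊ : ℝ) ^ 2 ≤ w * (2 * S * (w : ℝ)⁻¹) ^ 2 := by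
                gcongr
                exact hLu w hw
            _ = 4 * S ^ 2 * (w : ℝ)⁻¹ := by field_simp; norm_num
      _ = 4 * S ^ 2 * H := by rw [← Finset.mul_sum, hH]
      _ = 4 * (t ^ 2 / (M ^ 8 * H)) := by rw [hS]; field_simp
  refine ⟨M, R, fun w => ⌈S / w⌉₊, hM3, fun w hw => ?_, fun w hw => ?_, ?_, ?_⟩
  · rw [hR, Finset.mem_Icc] at hw
    exact ⟨hW1.trans hw.1, hw.2⟩
  · rw [Nat.ceil_le, div_le_iff₀ (hRpos w hw)]
    have : (W : ℝ) ≤ w := by exact_mod_cast (Finset.mem_Icc.1 hw).1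
    nlinarith
  · have h1 : S * H ≤ ∑ w ∈ R, (⌈S / w⌉₊ : ℝ) := by
      rw [hH, Finset.mul_sum]
      exact Finset.sum_le_sum hLl
    rw [hSH, div_le_iff₀ (by positivity), mul_comm] at h1
    exact_mod_cast h1
  · push_cast
    have hℓ0 : 0 < ℓ := by linarith
    have hmM : (m : ℝ) ^ 6 ≤ 4096 * M ^ 6 := by
      calc (m : ℝ) ^ 6 ≤ (4 * (M : ℝ)) ^ 6 := by gcongr
        _ = 4096 * (M : ℝ) ^ 6 := by ring
    have h1 : 4 * (t : ℝ) / M ≤ 16 * (t ^ 2 / (m ^ 6 * ℓ)) := by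
      have h2 : (m : ℝ) ^ 5 * ℓ ≤ t := by
        refine le_trans ?_ ht
        gcongr
        linarith
      calc 4 * (t : ℝ) / M ≤ 4 * t / (m / 4) := by gcongr; linarith
        _ = 16 * (t * (m ^ 5 * ℓ) / (m ^ 6 * ℓ)) := by field_simp; norm_num
        _ ≤ 16 * (t * t / (m ^ 6 * ℓ)) := by gcongr
        _ = 16 * (t ^ 2 / (m ^ 6 * ℓ)) := by rw [sq]
    have h3 : 8 * ((t : ℝ) ^ 2 / (M ^ 6 * H)) ≤ 65536 * (t ^ 2 / (m ^ 6 * ℓ)) := by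
      calc 8 * ((t : ℝ) ^ 2 / (M ^ 6 * H)) ≤ 8 * (t ^ 2 / (m ^ 6 / 4096 * (ℓ / 2))) := by
            gcongr
            linarith
        _ = 65536 * (t ^ 2 / (m ^ 6 * ℓ)) := by field_simp; norm_num
    calc 2 * (M : ℝ) ^ 3 * ∑ w ∈ R, (⌈S / w⌉₊ : ℝ) +
          2 * M ^ 2 * ∑ w ∈ R, (w : ℝ) * (⌈S / w⌉₊ : ℝ) ^ 2
        ≤ 2 * (M : ℝ) ^ 3 * (2 * (t / M ^ 4)) + 2 * M ^ 2 * (4 * (t ^ 2 / (M ^ 8 * H))) := by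
          gcongr
      _ = 4 * (t : ℝ) / M + 8 * ((t : ℝ) ^ 2 / (M ^ 6 * H)) := by
          field_simp
          ring
      _ ≤ 16 * (t ^ 2 / (m ^ 6 * ℓ)) + 65536 * (t ^ 2 / (m ^ 6 * ℓ)) := add_le_add h1 h3
      _ = 65552 * (t : ℝ) ^ 2 / (m ^ 6 * ℓ) := by ring

open Classical in
/-- Filtering a family of finsets after coercing its members to sets, the coercion of the family
being the monadic one, gives no more members than filtering the family itself. -/
lemma card_filter_bind_pure_coe_le {α : Type*} (T : Finset (Finset α)) (p : Set α → Prop) :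
    ((do let a ← T; pure (↑a : Set α) : Finset (Set α)).filter p).card ≤
      (T.filter fun s : Finset α => p (↑s : Set α)).card := by
  have h : (do let a ← T; pure (↑a : Set α) : Finset (Set α)) =
      T.image fun s : Finset α => (↑s : Set α) := by
    ext s
    simp [eq_comm]
  rw [h, Finset.filter_image]
  exact Finset.card_image_le

open Classical in
/-- Second selection lemma, upper bound: there exist `C > 0` and `m₀` such that for all
`m ≥ m₀`, with `n = m²`, and all `t` with `n^{5/2}·log n ≤ t ≤ C(n,3)`, there is an
`n`-point set `X ⊂ ℝ²` and a family `T` of `t` triangles with vertices in `X` such that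
every point of the plane lies in at most `C·t²/(n³·log(n³/t))` triangles of `T`. -/
theorem second_selection_upper_bound :
    ∃ C : ℝ, 0 < C ∧ ∃ m₀ : ℕ, ∀ m : ℕ, m₀ ≤ m →
      ∀ t : ℕ, ((m ^ 2 : ℝ) ^ ((5 : ℝ) / 2) * Real.log (m ^ 2 : ℝ) ≤ t) →
        t ≤ (m ^ 2).choose 3 →
        ∃ X : Finset (ℝ × ℝ), X.card = m ^ 2 ∧
          ∃ T : Finset (Finset (ℝ × ℝ)), T.card = t ∧
            (∀ s ∈ T, s ⊆ X ∧ s.card = 3) ∧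
            ∀ q : ℝ × ℝ,
              ((T.filter (fun s => q ∈ convexHull ℝ (↑s : Set (ℝ × ℝ)))).card : ℝ) ≤
                C * (t : ℝ) ^ 2 /
                  ((m ^ 2 : ℝ) ^ 3 * Real.log ((m ^ 2 : ℝ) ^ 3 / (t : ℝ))) := by
  refine ⟨65552 + 18 * Real.exp 18, by positivity, 12, fun m hm t ht htc => ?_⟩
  have hm' : (12 : ℝ) ≤ m := by exact_mod_cast hm
  have hm0 : (0 : ℝ) < m := by linarith
  have hK : (1 : ℝ) < 2 * m := by linarith
  have hpow : ((m : ℝ) ^ 2) ^ ((5 : ℝ) / 2) = (m : ℝ) ^ 5 := by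
    rw [← Real.rpow_natCast, ← Real.rpow_mul hm0.le, ← Real.rpow_natCast]
    norm_num
  rw [hpow, Real.log_pow, Nat.cast_ofNat] at ht
  have hlogm : 0 < Real.log m := Real.log_pos (by linarith)
  have ht0 : (0 : ℝ) < t := lt_of_lt_of_le (by positivity) ht
  have htlt : (t : ℝ) < (m : ℝ) ^ 6 := by
    have h1 : (t : ℝ) ≤ ((m ^ 2 : ℕ) : ℝ) ^ 3 / (3).factorial :=
      le_trans (by exact_mod_cast htc) (Nat.choose_le_pow_div 3 (m ^ 2))
    have h2 : 0 < (m : ℝ) ^ 6 := by positivity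
    have h3 : ((3).factorial : ℝ) = 6 := by norm_num [Nat.factorial]
    rw [h3, Nat.cast_pow, ← pow_mul] at h1
    norm_num at h1
    linarith
  have hℓ0 : 0 < Real.log ((m : ℝ) ^ 6 / t) := Real.log_pos ((one_lt_div ht0).2 htlt)
  have hm6 : ((m : ℝ) ^ 2) ^ 3 = (m : ℝ) ^ 6 := by ring
  rw [hm6]
  refine ⟨stretchedGrid (2 * m) m, card_stretchedGrid hK m, ?_⟩
  by_cases hℓ : 18 ≤ Real.log ((m : ℝ) ^ 6 / t)
  · obtain ⟨M, R, L, hM, hR, hL, htL, hbound⟩ := exists_boxShapes hm ht hℓ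
    have hinj := boxTriangle_injOn hK (L := L) hR
    obtain ⟨T, hT, hTt⟩ := Finset.exists_subset_card_eq
      (s := (boxIndices M R L).image (boxTriangle (2 * m))) (n := t)
      (by rwa [Finset.card_image_of_injOn hinj, card_boxIndices])
    refine ⟨T, hTt, fun s hs => ?_, fun q => ?_⟩
    · obtain ⟨p, hp, rfl⟩ := Finset.mem_image.1 (hT hs)
      exact boxTriangle_subset_card hK hM hR hL hp
    · have hcard : (T.filter fun s : Finset (ℝ × ℝ) =>
          q ∈ convexHull ℝ (↑s : Set (ℝ × ℝ))).card ≤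
          2 * M ^ 3 * ∑ w ∈ R, L w + 2 * M ^ 2 * ∑ w ∈ R, w * L w ^ 2 := by
        refine le_trans ?_ (card_filter_mem_convexHull_le (by omega) hM hR q)
        refine (Finset.card_le_card (Finset.filter_subset_filter _ hT)).trans ?_
        rw [Finset.filter_image]
        exact Finset.card_image_le
      refine (Nat.cast_le.2 ((card_filter_bind_pure_coe_le T _).trans hcard)).trans
        (hbound.trans ?_)
      gcongr
      linarith [Real.exp_pos 18]
  · push Not at hℓ
    obtain ⟨T, hT, hTt⟩ := Finset.exists_subset_card_eq
      (s := (stretchedGrid (2 * m) m).powersetCard 3) (n := t)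
      (by rwa [Finset.card_powersetCard, card_stretchedGrid hK])
    refine ⟨T, hTt, fun s hs => Finset.mem_powersetCard.1 (hT hs), fun q => ?_⟩
    have h1 : ((T.filter fun s : Finset (ℝ × ℝ) =>
        q ∈ convexHull ℝ (↑s : Set (ℝ × ℝ))).card : ℝ) ≤ t := by
      rw [← hTt]
      exact_mod_cast Finset.card_filter_le _ _
    have h2 : (m : ℝ) ^ 6 ≤ Real.exp 18 * t := by
      rw [← div_le_iff₀ ht0]
      exact (Real.log_le_iff_le_exp (by positivity)).1 hℓ.le
    refine (Nat.cast_le.2 (card_filter_bind_pure_coe_le T _)).trans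
      (h1.trans ((le_div_iff₀ (by positivity)).2 ?_))
    calc (t : ℝ) * ((m : ℝ) ^ 6 * Real.log ((m : ℝ) ^ 6 / t))
        ≤ t * (Real.exp 18 * t * 18) := by gcongr
      _ = 18 * Real.exp 18 * t ^ 2 := by ring
      _ ≤ (65552 + 18 * Real.exp 18) * t ^ 2 := by gcongr; linarith
end
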